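/- Let δ > −1. There exist constants C > 0 and γ > 0 such that for all k ∈ ℕ, setting ν = 4k + 2δ + 2, the normalized Laguerre function satisfies: |𝓛_k^δ(τ)| ≤ C(τν)^{δ/2} for 0 ≤ τ ≤ 1/ν; |𝓛_k^δ(τ)| ≤ C(τν)^{−1/4} for 1/ν ≤ τ ≤ ν/2; |𝓛_k^δ(τ)| ≤ C ν^{−1/4}(ν^{1/3} + |ν − τ|)^{−1/4} for ν/2 ≤ τ ≤ 3ν/2; and |𝓛_k^δ(τ)| ≤ C e^{−γτ} for τ ≥ 3ν/2. -/

import Mathlib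

open MeasureTheory
open scoped ENNReal

noncomputable section

/-- Laguerre polynomial of type `δ` and degree `k`. -/
def laguerreL (k : ℕ) (δ : ℝ) (τ : ℝ) : ℝ :=
  (1 / (Nat.factorial k : ℝ)) * Real.exp τ * τ ^ (-δ) *
    iteratedDeriv k (fun s : ℝ => Real.exp (-s) * s ^ ((k : ℝ) + δ)) τ

/-- normalized Laguerre function 𝓛_k^δ -/
def laguerreNorm (k : ℕ) (δ : ℝ) (τ : ℝ) : ℝ :=
  Real.sqrt (Real.Gamma ((k : ℝ) + 1) / Real.Gamma ((k : ℝ) + δ + 1)) *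
    Real.exp (-τ / 2) * τ ^ (δ / 2) * laguerreL k δ τ

end

theorem le_of_hasDerivAt_nonpos {f f' : ℝ → ℝ} {a b : ℝ} (hab : a ≤ b)
    (hf : ∀ x ∈ Set.Icc a b, HasDerivAt f (f' x) x) (hf' : ∀ x ∈ Set.Icc a b, f' x ≤ 0) :
    f b ≤ f a := by
  refine antitoneOn_of_hasDerivWithinAt_nonpos (convex_Icc a b) (f' := f')
    (fun x hx => (hf x hx).continuousAt.continuousWithinAt)
    (fun x hx => (hf x (interior_subset hx)).hasDerivWithinAt)
    (fun x hx => hf' x (interior_subset hx)) (Set.left_mem_Icc.2 hab) (Set.right_mem_Icc.2 hab) hab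

/-- The Sonin energy of a solution `u` of `u'' = -Q u`, with `v = u'`. -/
noncomputable def soninEnergy (Q u v : ℝ → ℝ) (x : ℝ) : ℝ := Q x * u x ^ 2 + v x ^ 2

theorem hasDerivAt_soninEnergy {Q u v : ℝ → ℝ} {Q₁ x : ℝ} (hQ : HasDerivAt Q Q₁ x)
    (hu : HasDerivAt u (v x) x) (hv : HasDerivAt v (-Q x * u x) x) :
    HasDerivAt (soninEnergy Q u v) (Q₁ * u x ^ 2) x := by
  have h := (hQ.mul (hu.pow 2)).add (hv.pow 2)
  refine h.congr_deriv ?_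
  simp
  ring

theorem mul_le_soninEnergy {Q u v : ℝ → ℝ} {x : ℝ} :
    Q x * u x ^ 2 ≤ soninEnergy Q u v x := by
  unfold soninEnergy
  nlinarith [sq_nonneg (v x)]

theorem soninEnergy_nonneg {Q u v : ℝ → ℝ} {x : ℝ} (hQ : 0 ≤ Q x) :
    0 ≤ soninEnergy Q u v x := by
  unfold soninEnergy
  positivity

theorem abs_mul_le_soninEnergy {Q u v : ℝ → ℝ} {x : ℝ} (hQ : 0 ≤ Q x) :
    2 * √(Q x) * |u x * v x| ≤ soninEnergy Q u v x := by
  unfold soninEnergy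
  have h := Real.sq_sqrt hQ
  rw [abs_mul, ← sq_abs (u x), ← sq_abs (v x)]
  nlinarith [sq_nonneg (√(Q x) * |u x| - |v x|)]

/-- Liouville–Green bound: the energy grows at most like `√Q` as long as `|Q'| ≤ Q ^ (3 / 2)`. -/
theorem soninEnergy_div_sqrt_le {Q Q₁ Q₂ u v : ℝ → ℝ} {a b : ℝ} (hab : a ≤ b)
    (hQ : ∀ x ∈ Set.Icc a b, HasDerivAt Q (Q₁ x) x)
    (hQ₁ : ∀ x ∈ Set.Icc a b, HasDerivAt Q₁ (Q₂ x) x)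
    (hu : ∀ x ∈ Set.Icc a b, HasDerivAt u (v x) x)
    (hv : ∀ x ∈ Set.Icc a b, HasDerivAt v (-Q x * u x) x)
    (hpos : ∀ x ∈ Set.Icc a b, 0 < Q x)
    (hslow : ∀ x ∈ Set.Icc a b, |Q₁ x| ≤ Q x * √(Q x))
    (hconc : ∀ x ∈ Set.Icc a b, Q₂ x ≤ 0) :
    soninEnergy Q u v b / √(Q b) ≤ 5 * (soninEnergy Q u v a / √(Q a)) := by
  set F : ℝ → ℝ := fun x => soninEnergy Q u v x + Q₁ x / (2 * Q x) * (u x * v x) with hF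
  set Θ : ℝ → ℝ := fun x => Q₁ x / (2 * (Q x * √(Q x))) with hΘ
  have hkey : ∀ x ∈ Set.Icc a b, |Q₁ x / (2 * Q x) * (u x * v x)| ≤ soninEnergy Q u v x / 4 := by
    intro x hx
    have hp := hpos x hx
    have h1 := abs_mul_le_soninEnergy (u := u) (v := v) hp.le
    have h2 : |Q₁ x / (2 * Q x)| ≤ √(Q x) / 2 := by
      rw [abs_div, abs_of_pos (by positivity : 0 < 2 * Q x), div_le_iff₀ (by positivity)]
      linarith [hslow x hx]
    rw [abs_mul]
    nlinarith [mul_le_mul_of_nonneg_right h2 (abs_nonneg (u x * v x))]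
  have hΘle : ∀ x ∈ Set.Icc a b, |Θ x| ≤ 1 / 2 := by
    intro x hx
    have hp := hpos x hx
    have hs := Real.sqrt_pos.2 hp
    rw [hΘ, abs_div, abs_of_pos (by positivity : 0 < 2 * (Q x * √(Q x))),
      div_le_iff₀ (by positivity)]
    linarith [hslow x hx]
  have hmono : F b / √(Q b) * Real.exp (Θ b) ≤ F a / √(Q a) * Real.exp (Θ a) := by
    refine le_of_hasDerivAt_nonpos (f := fun x => F x / √(Q x) * Real.exp (Θ x))
      (f' := fun x => Real.exp (Θ x) *
        ((Q₂ x / (2 * Q x) - 3 / 4 * (Q₁ x ^ 2 / Q x ^ 2)) / √(Q x) *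
          (u x * v x + F x / √(Q x)))) hab ?_ ?_
    · intro x hx
      have hp := hpos x hx
      have hs := Real.sqrt_pos.2 hp
      have hsq := Real.sq_sqrt hp.le
      have hdS : HasDerivAt (fun y => √(Q y)) (Q₁ x / (2 * √(Q x))) x := (hQ x hx).sqrt hp.ne'
      have hdF : HasDerivAt F (Q₁ x * u x ^ 2 +
          (((Q₂ x * (2 * Q x) - Q₁ x * (2 * Q₁ x)) / (2 * Q x) ^ 2) * (u x * v x) +
            Q₁ x / (2 * Q x) * (v x * v x + u x * (-Q x * u x)))) x :=
        (hasDerivAt_soninEnergy (hQ x hx) (hu x hx) (hv x hx)).add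
          (((hQ₁ x hx).div ((hQ x hx).const_mul 2) (by positivity)).mul ((hu x hx).mul (hv x hx)))
      have hdΘ : HasDerivAt Θ ((Q₂ x * (2 * (Q x * √(Q x))) -
          Q₁ x * (2 * (Q₁ x * √(Q x) + Q x * (Q₁ x / (2 * √(Q x)))))) /
            (2 * (Q x * √(Q x))) ^ 2) x :=
        (hQ₁ x hx).div (((hQ x hx).mul hdS).const_mul 2) (by positivity)
      refine ((hdF.div hdS hs.ne').mul hdΘ.exp).congr_deriv ?_
      have hFx : F x = Q x * u x ^ 2 + v x ^ 2 + Q₁ x / (2 * Q x) * (u x * v x) := rfl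
      simp only [Pi.div_apply]
      rw [hFx]
      generalize Real.exp (Θ x) = e
      generalize √(Q x) = s at hs hsq
      rw [← hsq]
      field_simp
      ring
    · intro x hx
      have hp := hpos x hx
      have hs := Real.sqrt_pos.2 hp
      have hrho : (Q₂ x / (2 * Q x) - 3 / 4 * (Q₁ x ^ 2 / Q x ^ 2)) / √(Q x) ≤ 0 := by
        apply div_nonpos_of_nonpos_of_nonneg _ hs.le
        have h1 : Q₂ x / (2 * Q x) ≤ 0 :=
          div_nonpos_of_nonpos_of_nonneg (hconc x hx) (by positivity)
        have h2 : 0 ≤ Q₁ x ^ 2 / Q x ^ 2 := by positivity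
        linarith
      have hnn : 0 ≤ u x * v x + F x / √(Q x) := by
        have h1 := abs_mul_le_soninEnergy (u := u) (v := v) hp.le
        have h2 := neg_abs_le (u x * v x)
        have h3 := (abs_le.1 (hkey x hx)).1
        have h0 := soninEnergy_nonneg (u := u) (v := v) hp.le
        have h4 : F x ≥ 3 / 4 * soninEnergy Q u v x := by simp only [hF]; linarith
        have h5 : |u x * v x| ≤ F x / √(Q x) := by
          rw [le_div_iff₀ hs]; nlinarith
        linarith
      exact mul_nonpos_of_nonneg_of_nonpos (Real.exp_pos _).le
        (mul_nonpos_of_nonpos_of_nonneg hrho hnn)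
  have ha := Set.left_mem_Icc.2 hab
  have hb := Set.right_mem_Icc.2 hab
  have hsa := Real.sqrt_pos.2 (hpos a ha)
  have hsb := Real.sqrt_pos.2 (hpos b hb)
  have hGa := soninEnergy_nonneg (u := u) (v := v) (hpos a ha).le
  have hGb := soninEnergy_nonneg (u := u) (v := v) (hpos b hb).le
  have hFa : F a ≤ 5 / 4 * soninEnergy Q u v a := by
    have := (abs_le.1 (hkey a ha)).2
    simp only [hF]; linarith
  have hFb : 3 / 4 * soninEnergy Q u v b ≤ F b := by
    have := (abs_le.1 (hkey b hb)).1
    simp only [hF]; linarith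
  have he : Real.exp (Θ a) ≤ 3 * Real.exp (Θ b) := by
    have h1 := (abs_le.1 (hΘle a ha)).2
    have h2 := (abs_le.1 (hΘle b hb)).1
    calc Real.exp (Θ a) ≤ Real.exp (1 + Θ b) := Real.exp_le_exp.2 (by linarith)
      _ = Real.exp 1 * Real.exp (Θ b) := Real.exp_add _ _
      _ ≤ 3 * Real.exp (Θ b) := by
        have := Real.exp_one_lt_d9
        gcongr
        linarith
  have h1 : 3 / 4 * (soninEnergy Q u v b / √(Q b)) * Real.exp (Θ b) ≤
      5 / 4 * (soninEnergy Q u v a / √(Q a)) * (3 * Real.exp (Θ b)) := by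
    calc 3 / 4 * (soninEnergy Q u v b / √(Q b)) * Real.exp (Θ b)
        = (3 / 4 * soninEnergy Q u v b) / √(Q b) * Real.exp (Θ b) := by ring
      _ ≤ F b / √(Q b) * Real.exp (Θ b) := by gcongr
      _ ≤ F a / √(Q a) * Real.exp (Θ a) := hmono
      _ ≤ (5 / 4 * soninEnergy Q u v a) / √(Q a) * (3 * Real.exp (Θ b)) := by gcongr
      _ = _ := by ring
  have he0 := Real.exp_pos (Θ b)
  have h2 : 3 / 4 * (soninEnergy Q u v b / √(Q b)) ≤
      15 / 4 * (soninEnergy Q u v a / √(Q a)) :=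
    le_of_mul_le_mul_right (by linarith) he0
  linarith

/-- Where `Q` is of constant order, the energy stays bounded even if `Q` grows slowly. -/
theorem soninEnergy_le_of_deriv_le {Q Q₁ u v : ℝ → ℝ} {a b c : ℝ} (ha : 0 < a) (hab : a ≤ b)
    (hQ : ∀ x ∈ Set.Icc a b, HasDerivAt Q (Q₁ x) x)
    (hu : ∀ x ∈ Set.Icc a b, HasDerivAt u (v x) x)
    (hv : ∀ x ∈ Set.Icc a b, HasDerivAt v (-Q x * u x) x)
    (hpos : ∀ x ∈ Set.Icc a b, 0 ≤ Q x) (hc0 : 0 ≤ c) (hc : c ≤ a ^ 2)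
    (hslow : ∀ x ∈ Set.Icc a b, Q₁ x ≤ 2 * c / x ^ 3 * Q x) :
    soninEnergy Q u v b ≤ 3 * soninEnergy Q u v a := by
  have hmono : soninEnergy Q u v b * Real.exp (c / b ^ 2) ≤
      soninEnergy Q u v a * Real.exp (c / a ^ 2) := by
    refine le_of_hasDerivAt_nonpos (f := fun x => soninEnergy Q u v x * Real.exp (c / x ^ 2))
      (f' := fun x => (Q₁ x * u x ^ 2 - 2 * c / x ^ 3 * soninEnergy Q u v x) *
        Real.exp (c / x ^ 2)) hab ?_ ?_
    · intro x hx
      have hx0 : 0 < x := ha.trans_le hx.1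
      have h1 : HasDerivAt (fun y : ℝ => c / y ^ 2) (-(2 * c / x ^ 3)) x := by
        refine ((hasDerivAt_const x c).div (hasDerivAt_pow 2 x) (by positivity)).congr_deriv ?_
        simp
        field_simp
      refine ((hasDerivAt_soninEnergy (hQ x hx) (hu x hx) (hv x hx)).mul h1.exp).congr_deriv ?_
      ring
    · intro x hx
      have hx0 : 0 < x := ha.trans_le hx.1
      refine mul_nonpos_of_nonpos_of_nonneg ?_ (Real.exp_pos _).le
      have h1 := mul_le_mul_of_nonneg_right (hslow x hx) (sq_nonneg (u x))
      have h2 : 2 * c / x ^ 3 * (Q x * u x ^ 2) ≤ 2 * c / x ^ 3 * soninEnergy Q u v x :=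
        mul_le_mul_of_nonneg_left mul_le_soninEnergy (by positivity)
      linarith
  have hGa := soninEnergy_nonneg (u := u) (v := v) (hpos a (Set.left_mem_Icc.2 hab))
  have hGb := soninEnergy_nonneg (u := u) (v := v) (hpos b (Set.right_mem_Icc.2 hab))
  have he1 : 1 ≤ Real.exp (c / b ^ 2) := Real.one_le_exp (by positivity)
  have he2 : Real.exp (c / a ^ 2) ≤ 3 := by
    have h1 : c / a ^ 2 ≤ 1 := by rw [div_le_one (by positivity)]; exact hc
    have := Real.exp_one_lt_d9
    linarith [Real.exp_le_exp.2 h1]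
  nlinarith

/-- Grönwall bound across a turning point, in an interval of length comparable to the inverse
of the local frequency `w`. -/
theorem sq_add_sq_le_of_abs_le {Q u v : ℝ → ℝ} {a b w L : ℝ} (hab : a ≤ b) (hw : 0 < w)
    (hL : w * (b - a) ≤ L)
    (hu : ∀ x ∈ Set.Icc a b, HasDerivAt u (v x) x)
    (hv : ∀ x ∈ Set.Icc a b, HasDerivAt v (-Q x * u x) x)
    (hQ : ∀ x ∈ Set.Icc a b, |Q x| ≤ 6 * w ^ 2) :
    w ^ 2 * u b ^ 2 + v b ^ 2 ≤ Real.exp (7 * L) * (w ^ 2 * u a ^ 2 + v a ^ 2) := by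
  have hmono : (w ^ 2 * u b ^ 2 + v b ^ 2) * Real.exp (-(7 * w * b)) ≤
      (w ^ 2 * u a ^ 2 + v a ^ 2) * Real.exp (-(7 * w * a)) := by
    refine le_of_hasDerivAt_nonpos
      (f := fun x => (w ^ 2 * u x ^ 2 + v x ^ 2) * Real.exp (-(7 * w * x)))
      (f' := fun x => (2 * (w ^ 2 - Q x) * (u x * v x) - 7 * w * (w ^ 2 * u x ^ 2 + v x ^ 2)) *
        Real.exp (-(7 * w * x))) hab ?_ ?_
    · intro x hx
      have h1 : HasDerivAt (fun y : ℝ => -(7 * w * y)) (-(7 * w)) x := by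
        exact ((hasDerivAt_id' x).const_mul (7 * w)).neg.congr_deriv (by ring)
      refine (((((hu x hx).pow 2).const_mul (w ^ 2)).add ((hv x hx).pow 2)).mul
        h1.exp).congr_deriv ?_
      simp
      ring
    · intro x hx
      refine mul_nonpos_of_nonpos_of_nonneg ?_ (Real.exp_pos _).le
      have h1 : |w ^ 2 - Q x| ≤ 7 * w ^ 2 := by
        have := abs_le.1 (hQ x hx)
        rw [abs_le]; constructor <;> nlinarith
      have h2 : (w ^ 2 - Q x) * (u x * v x) ≤ 7 * w ^ 2 * |u x * v x| := by
        calc _ ≤ |(w ^ 2 - Q x) * (u x * v x)| := le_abs_self _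
          _ = |w ^ 2 - Q x| * |u x * v x| := abs_mul _ _
          _ ≤ _ := by gcongr
      have h3 : 2 * w * |u x * v x| ≤ w ^ 2 * u x ^ 2 + v x ^ 2 := by
        rw [abs_mul, ← sq_abs (u x), ← sq_abs (v x)]
        nlinarith [sq_nonneg (w * |u x| - |v x|)]
      nlinarith [mul_le_mul_of_nonneg_left h3 (by positivity : 0 ≤ 7 * w)]
  have h2 : Real.exp (-(7 * w * a)) = Real.exp (7 * (w * (b - a))) * Real.exp (-(7 * w * b)) := by
    rw [← Real.exp_add]; congr 1; ring
  rw [h2, ← mul_assoc] at hmono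
  have h3 := le_of_mul_le_mul_right hmono (Real.exp_pos _)
  have h4 : Real.exp (7 * (w * (b - a))) ≤ Real.exp (7 * L) := Real.exp_le_exp.2 (by linarith)
  have h5 : 0 ≤ w ^ 2 * u a ^ 2 + v a ^ 2 := by positivity
  nlinarith [mul_le_mul_of_nonneg_right h4 h5]

theorem nonneg_of_tendsto_zero_of_deriv_nonpos {f f' : ℝ → ℝ} {a : ℝ}
    (hf : ∀ x, a ≤ x → HasDerivAt f (f' x) x) (hf' : ∀ x, a ≤ x → f' x ≤ 0)
    (hlim : Filter.Tendsto f Filter.atTop (nhds 0)) {x : ℝ} (hx : a ≤ x) : 0 ≤ f x := by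
  refine le_of_tendsto hlim ?_
  filter_upwards [Filter.eventually_ge_atTop x] with y hy
  exact le_of_hasDerivAt_nonpos hy (fun z hz => hf z (hx.trans hz.1))
    (fun z hz => hf' z (hx.trans hz.1))

/-- Beyond the turning point a decaying solution decays at least at the exponential rate `√(-Q)`. -/
theorem mul_deriv_le_of_tendsto_zero {Q Q₁ u v : ℝ → ℝ} {a : ℝ}
    (hQ : ∀ x, a ≤ x → HasDerivAt Q (Q₁ x) x)
    (hu : ∀ x, a ≤ x → HasDerivAt u (v x) x)
    (hv : ∀ x, a ≤ x → HasDerivAt v (-Q x * u x) x)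
    (hneg : ∀ x, a ≤ x → Q x ≤ 0) (hdec : ∀ x, a ≤ x → Q₁ x ≤ 0)
    (hlimG : Filter.Tendsto (soninEnergy Q u v) Filter.atTop (nhds 0))
    (hlim : Filter.Tendsto (fun x => u x * v x) Filter.atTop (nhds 0)) {x : ℝ} (hx : a ≤ x) :
    u x * v x ≤ -√(-Q x) * u x ^ 2 := by
  have hG : 0 ≤ soninEnergy Q u v x :=
    nonneg_of_tendsto_zero_of_deriv_nonpos
      (fun y hy => hasDerivAt_soninEnergy (hQ y hy) (hu y hy) (hv y hy))
      (fun y hy => mul_nonpos_of_nonpos_of_nonneg (hdec y hy) (sq_nonneg _)) hlimG hx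
  have huv : 0 ≤ -(u x * v x) := by
    refine nonneg_of_tendsto_zero_of_deriv_nonpos (f := fun y => -(u y * v y))
      (f' := fun y => -(v y * v y + u y * (-Q y * u y)))
      (fun y hy => ((hu y hy).mul (hv y hy)).neg) (fun y hy => ?_) (by simpa using hlim.neg) hx
    nlinarith [hneg y hy, sq_nonneg (v y), mul_nonneg (neg_nonneg.2 (hneg y hy)) (sq_nonneg (u y))]
  have hq : 0 ≤ -Q x := neg_nonneg.2 (hneg x hx)
  have hs := Real.sq_sqrt hq
  have hsq : (√(-Q x) * u x ^ 2) ^ 2 ≤ (-(u x * v x)) ^ 2 := by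
    unfold soninEnergy at hG
    have h1 : (√(-Q x)) ^ 2 * u x ^ 2 ≤ v x ^ 2 := by rw [hs]; linarith
    nlinarith [mul_le_mul_of_nonneg_right h1 (sq_nonneg (u x))]
  have := abs_le_of_sq_le_sq' hsq huv
  linarith [this.2]

/-- Amplitude bound `u ^ 4 ≲ 1 / |Q|` beyond the turning point. -/
theorem neg_mul_pow_four_le {Q Q₁ u v : ℝ → ℝ} {a b : ℝ} (hab : a ≤ b)
    (hQ : ∀ x ∈ Set.Icc a b, HasDerivAt Q (Q₁ x) x)
    (hu : ∀ x ∈ Set.Icc a b, HasDerivAt u (v x) x)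
    (hneg : ∀ x ∈ Set.Icc a b, Q x ≤ 0)
    (hslow : ∀ x ∈ Set.Icc a b, -Q₁ x ≤ 4 * (-Q x * √(-Q x)))
    (huv : ∀ x ∈ Set.Icc a b, u x * v x ≤ -√(-Q x) * u x ^ 2) :
    -Q b * u b ^ 4 ≤ -Q a * u a ^ 4 := by
  refine le_of_hasDerivAt_nonpos (f := fun x => -Q x * u x ^ 4)
    (f' := fun x => -Q₁ x * u x ^ 4 + 4 * -Q x * (u x ^ 2 * (u x * v x))) hab ?_ ?_
  · intro x hx
    refine ((hQ x hx).neg.mul ((hu x hx).pow 4)).congr_deriv ?_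
    simp
    ring
  · intro x hx
    have h1 := mul_le_mul_of_nonneg_left (huv x hx) (sq_nonneg (u x))
    have h2 := mul_le_mul_of_nonneg_left h1
      (by linarith [hneg x hx] : 0 ≤ 4 * -Q x)
    have h3 := mul_le_mul_of_nonneg_right (hslow x hx) (by positivity : 0 ≤ u x ^ 4)
    nlinarith

/-- Gaussian decay far beyond the turning point. -/
theorem sq_mul_exp_le {Q u v : ℝ → ℝ} {a b : ℝ} (hab : a ≤ b)
    (hu : ∀ x ∈ Set.Icc a b, HasDerivAt u (v x) x)
    (hrate : ∀ x ∈ Set.Icc a b, x / 3 ≤ √(-Q x))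
    (huv : ∀ x ∈ Set.Icc a b, u x * v x ≤ -√(-Q x) * u x ^ 2) :
    u b ^ 2 * Real.exp (b ^ 2 / 3) ≤ u a ^ 2 * Real.exp (a ^ 2 / 3) := by
  refine le_of_hasDerivAt_nonpos (f := fun x => u x ^ 2 * Real.exp (x ^ 2 / 3))
    (f' := fun x => 2 * (u x * v x + x / 3 * u x ^ 2) * Real.exp (x ^ 2 / 3)) hab ?_ ?_
  · intro x hx
    refine (((hu x hx).pow 2).mul (((hasDerivAt_pow 2 x).div_const 3).exp)).congr_deriv ?_
    simp
    ring
  · intro x hx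
    have h1 := mul_le_mul_of_nonneg_right (hrate x hx) (sq_nonneg (u x))
    have h2 := huv x hx
    exact mul_nonpos_of_nonpos_of_nonneg (by linarith) (Real.exp_pos _).le

/-- The potential in the Liouville normal form `u'' = -Q u` of Laguerre's equation. -/
noncomputable def laguerrePotential (ν β x : ℝ) : ℝ := ν - x ^ 2 - β / x ^ 2

theorem hasDerivAt_laguerrePotential (ν β : ℝ) {x : ℝ} (hx : x ≠ 0) :
    HasDerivAt (laguerrePotential ν β) (-2 * x + 2 * β / x ^ 3) x := by
  refine (((hasDerivAt_const x ν).sub (hasDerivAt_pow 2 x)).sub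
    ((hasDerivAt_const x β).div (hasDerivAt_pow 2 x) (by positivity))).congr_deriv ?_
  simp
  field_simp
  ring

theorem hasDerivAt_laguerrePotential_deriv (β : ℝ) {x : ℝ} (hx : x ≠ 0) :
    HasDerivAt (fun x : ℝ => -2 * x + 2 * β / x ^ 3) (-2 - 6 * β / x ^ 4) x := by
  refine (((hasDerivAt_id' x).const_mul (-2)).add
    ((hasDerivAt_const x (2 * β)).div (hasDerivAt_pow 3 x) (by positivity))).congr_deriv ?_
  simp
  field_simp
  ring

section Uniform

variable {w β K a : ℝ} {u v : ℝ → ℝ}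

theorem abs_div_sq_le_one (hw : 10 ≤ w) (hβ : |β| ≤ w) {x : ℝ}
    (hx : w ^ 6 / 2 ≤ x ^ 2) : |β / x ^ 2| ≤ 1 := by
  have h5 : (10 : ℝ) ^ 5 ≤ w ^ 5 := by gcongr
  have h1 : w ≤ w ^ 6 / 2 := by nlinarith
  have h2 : 0 < x ^ 2 := by linarith
  rw [abs_div, abs_of_pos h2, div_le_one h2]
  linarith

theorem one_le_of_le_sq (hw : 10 ≤ w) {x : ℝ} (hx0 : 0 < x) (hx : w ^ 6 / 2 ≤ x ^ 2) :
    100 ≤ x := by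
  have h5 : (10 : ℝ) ^ 6 ≤ w ^ 6 := by gcongr
  nlinarith

theorem abs_two_mul_div_le_one (hw : 10 ≤ w) (hβ : |β| ≤ w) {x : ℝ} (hx0 : 0 < x)
    (hx : w ^ 6 / 2 ≤ x ^ 2) : |2 * β / x ^ 3| ≤ 1 := by
  have h1 := abs_div_sq_le_one hw hβ hx
  have h2 := one_le_of_le_sq hw hx0 hx
  have h3 : 2 * β / x ^ 3 = 2 / x * (β / x ^ 2) := by field_simp
  have h4 : 2 / x ≤ 1 := by rw [div_le_one hx0]; linarith
  rw [h3, abs_mul, abs_of_pos (by positivity)]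
  nlinarith [abs_nonneg (β / x ^ 2), div_pos two_pos hx0]

theorem abs_laguerrePotential_sub_le (hw : 10 ≤ w) (hβ : |β| ≤ w) {x : ℝ}
    (hx : w ^ 6 / 2 ≤ x ^ 2) : |laguerrePotential (w ^ 6) β x - (w ^ 6 - x ^ 2)| ≤ 1 := by
  have h1 := abs_div_sq_le_one hw hβ hx
  unfold laguerrePotential
  rwa [sub_sub_cancel_left, abs_neg]

/-- Data of a solution of Laguerre's equation in Liouville normal form: spectral parameter `w ^ 6`,
energy at most `K * w ^ 3` at the point `a`, and decay at infinity. -/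
structure IsLaguerreSolution (w β K a : ℝ) (u v : ℝ → ℝ) : Prop where
  ten_le : 10 ≤ w
  abs_le : |β| ≤ w
  pos : 0 < a
  lower : 4 * |β| ≤ w ^ 6 * a ^ 2
  upper : a ^ 2 ≤ w ^ 6 / 2
  hu : ∀ x, 0 < x → HasDerivAt u (v x) x
  hv : ∀ x, 0 < x → HasDerivAt v (-laguerrePotential (w ^ 6) β x * u x) x
  energy_le : soninEnergy (laguerrePotential (w ^ 6) β) u v a ≤ K * w ^ 3
  tendsto_energy :
    Filter.Tendsto (soninEnergy (laguerrePotential (w ^ 6) β) u v) Filter.atTop (nhds 0)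
  tendsto_mul : Filter.Tendsto (fun x => u x * v x) Filter.atTop (nhds 0)

namespace IsLaguerreSolution

theorem le_potential {x : ℝ} (h : IsLaguerreSolution w β K a u v) (hax : a ≤ x)
    (hx : x ^ 2 ≤ w ^ 6 / 2) : w ^ 6 / 4 ≤ laguerrePotential (w ^ 6) β x := by
  have ha := h.pos
  have hx0 : 0 < x := ha.trans_le hax
  have h1 : β / x ^ 2 ≤ w ^ 6 / 4 := by
    rw [div_le_iff₀ (by positivity)]
    have h2 : a ^ 2 ≤ x ^ 2 := by gcongr
    have hw : 0 ≤ w ^ 6 := by linarith [sq_nonneg a, h.upper]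
    nlinarith [h.lower, le_abs_self β]
  unfold laguerrePotential
  linarith

theorem energy_le_of_le {x : ℝ} (h : IsLaguerreSolution w β K a u v) (hax : a ≤ x)
    (hx : x ^ 2 ≤ w ^ 6 / 2) :
    soninEnergy (laguerrePotential (w ^ 6) β) u v x ≤ 3 * K * w ^ 3 := by
  have ha := h.pos
  have hw := h.ten_le
  have hw6 : 0 < w ^ 6 := by positivity
  have hle : ∀ y ∈ Set.Icc a x, w ^ 6 / 4 ≤ laguerrePotential (w ^ 6) β y := fun y hy =>
    h.le_potential hy.1 (by nlinarith [hy.1, hy.2])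
  have h1 := soninEnergy_le_of_deriv_le (c := 4 * |β| / w ^ 6) ha hax
    (fun y hy => hasDerivAt_laguerrePotential (w ^ 6) β (ha.trans_le hy.1).ne')
    (fun y hy => h.hu y (ha.trans_le hy.1)) (fun y hy => h.hv y (ha.trans_le hy.1))
    (fun y hy => by linarith [hle y hy]) (by positivity)
    (by rw [div_le_iff₀ hw6]; linarith [h.lower]) (fun y hy => by
      have hy0 : 0 < y := ha.trans_le hy.1
      have h2 : 2 * (4 * |β| / w ^ 6) / y ^ 3 * (w ^ 6 / 4) ≤
          2 * (4 * |β| / w ^ 6) / y ^ 3 * laguerrePotential (w ^ 6) β y :=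
        mul_le_mul_of_nonneg_left (hle y hy) (by positivity)
      have h3 : 2 * (4 * |β| / w ^ 6) / y ^ 3 * (w ^ 6 / 4) = 2 * |β| / y ^ 3 := by
        field_simp
      have h4 : 2 * β / y ^ 3 ≤ 2 * |β| / y ^ 3 := by
        gcongr
        exact le_abs_self β
      linarith)
  linarith [h.energy_le]

/-- Bound in the bulk `x ^ 2 ≤ w ^ 6 / 2`. -/
theorem sq_mul_le {x : ℝ} (h : IsLaguerreSolution w β K a u v) (hax : a ≤ x)
    (hx : x ^ 2 ≤ w ^ 6 / 2) : u x ^ 2 * w ^ 3 ≤ 12 * K := by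
  have h1 := h.energy_le_of_le hax hx
  have h2 := mul_le_mul_of_nonneg_right (h.le_potential hax hx) (sq_nonneg (u x))
  have h3 := mul_le_soninEnergy (Q := laguerrePotential (w ^ 6) β) (u := u) (v := v) (x := x)
  have hw := h.ten_le
  have hw3 : 0 < w ^ 3 := by positivity
  have h4 : u x ^ 2 * w ^ 3 * w ^ 3 ≤ 12 * K * w ^ 3 := by nlinarith
  exact le_of_mul_le_mul_right h4 hw3

theorem K_nonneg (h : IsLaguerreSolution w β K a u v) : 0 ≤ K := by
  have h1 := h.sq_mul_le le_rfl h.upper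
  have hw := h.ten_le
  have : 0 ≤ u a ^ 2 * w ^ 3 := by positivity
  linarith

/-- Energy bound up to the turning point. -/
theorem energy_le_sqrt {x : ℝ} (h : IsLaguerreSolution w β K a u v) (hx0 : 0 < x)
    (hx : w ^ 6 / 2 ≤ x ^ 2) (hx' : x ^ 2 ≤ w ^ 6 - 5 * w ^ 2) :
    soninEnergy (laguerrePotential (w ^ 6) β) u v x ≤
      30 * K * √(laguerrePotential (w ^ 6) β x) := by
  have hw := h.ten_le
  have hw6 : 0 < w ^ 6 := by positivity
  have hw3 : 0 < w ^ 3 := by positivity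
  have hw6' : (10 : ℝ) ^ 6 ≤ w ^ 6 := by gcongr
  set m := √(w ^ 6 / 2) with hm
  have hm0 : 0 < m := Real.sqrt_pos.2 (by positivity)
  have hm2 : m ^ 2 = w ^ 6 / 2 := Real.sq_sqrt (by positivity)
  have hmx : m ≤ x := by rw [hm, Real.sqrt_le_left hx0.le]; exact hx
  have ham : a ≤ m := by
    have := h.upper
    exact Real.le_sqrt_of_sq_le this
  have hsq : ∀ y ∈ Set.Icc m x, 0 < y ∧ w ^ 6 / 2 ≤ y ^ 2 ∧ y ^ 2 ≤ w ^ 6 - 5 * w ^ 2 := by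
    intro y hy
    have hy0 : 0 < y := hm0.trans_le hy.1
    refine ⟨hy0, ?_, ?_⟩ <;> nlinarith [hy.1, hy.2]
  have hQ : ∀ y ∈ Set.Icc m x, 4 * w ^ 2 ≤ laguerrePotential (w ^ 6) β y := by
    intro y hy
    obtain ⟨_, h1, h2⟩ := hsq y hy
    have := (_root_.abs_le.1 (abs_laguerrePotential_sub_le hw h.abs_le h1)).1
    nlinarith
  have hS : ∀ y ∈ Set.Icc m x, 2 * w ≤ √(laguerrePotential (w ^ 6) β y) := fun y hy =>
    Real.le_sqrt_of_sq_le (by linarith [hQ y hy])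
  have hmain := soninEnergy_div_sqrt_le hmx
    (fun y hy => hasDerivAt_laguerrePotential (w ^ 6) β (hsq y hy).1.ne')
    (fun y hy => hasDerivAt_laguerrePotential_deriv β (hsq y hy).1.ne')
    (fun y hy => h.hu y (hsq y hy).1) (fun y hy => h.hv y (hsq y hy).1)
    (fun y hy => by nlinarith [hQ y hy]) (fun y hy => by
      obtain ⟨h0, h1, h2⟩ := hsq y hy
      have h3 := _root_.abs_le.1 (abs_two_mul_div_le_one hw h.abs_le h0 h1)
      have h4 : y ≤ w ^ 3 := by
        refine le_of_sq_le_sq ?_ hw3.le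
        nlinarith [sq_nonneg w]
      have h5 : 4 * w ^ 2 * (2 * w) ≤ laguerrePotential (w ^ 6) β y *
          √(laguerrePotential (w ^ 6) β y) :=
        mul_le_mul (hQ y hy) (hS y hy) (by positivity) (by nlinarith [hQ y hy])
      have h6 : (1000 : ℝ) ≤ w ^ 3 := by
        calc (1000 : ℝ) = 10 ^ 3 := by norm_num
          _ ≤ w ^ 3 := by gcongr
      rw [_root_.abs_le]
      constructor <;> nlinarith) (fun y hy => by
      obtain ⟨h0, h1, h2⟩ := hsq y hy
      have h3 := _root_.abs_le.1 (abs_div_sq_le_one hw h.abs_le h1)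
      have h4 := one_le_of_le_sq hw h0 h1
      have h5 : 6 * β / y ^ 4 = 6 / y ^ 2 * (β / y ^ 2) := by field_simp
      have h6 : 6 / y ^ 2 ≤ 1 := by rw [div_le_one (by positivity)]; nlinarith
      have h7 : 0 < 6 / y ^ 2 := by positivity
      rw [h5]
      nlinarith)
  have hGm := h.energy_le_of_le ham hm2.le
  have hSm : w ^ 3 / 2 ≤ √(laguerrePotential (w ^ 6) β m) :=
    Real.le_sqrt_of_sq_le (by nlinarith [h.le_potential ham hm2.le])
  have hSm0 : 0 < √(laguerrePotential (w ^ 6) β m) := by linarith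
  have hSx0 : 0 < √(laguerrePotential (w ^ 6) β x) := by
    linarith [hS x (Set.right_mem_Icc.2 hmx)]
  have hK := h.K_nonneg
  have h1 : soninEnergy (laguerrePotential (w ^ 6) β) u v m / √(laguerrePotential (w ^ 6) β m) ≤
      6 * K := by
    rw [div_le_iff₀ hSm0]
    nlinarith
  rw [← div_le_iff₀ hSx0]
  linarith

theorem pow_four_mul_le_left {x : ℝ} (h : IsLaguerreSolution w β K a u v) (hx0 : 0 < x)
    (hx : w ^ 6 / 2 ≤ x ^ 2) (hx' : x ^ 2 ≤ w ^ 6 - 5 * w ^ 2) :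
    u x ^ 4 * (w ^ 2 + |w ^ 6 - x ^ 2|) ≤ 1800 * K ^ 2 := by
  have hw := h.ten_le
  have h1 := h.energy_le_sqrt hx0 hx hx'
  have h2 := mul_le_soninEnergy (Q := laguerrePotential (w ^ 6) β) (u := u) (v := v) (x := x)
  have h3 := (_root_.abs_le.1 (abs_laguerrePotential_sub_le hw h.abs_le hx)).1
  rw [abs_of_nonneg (by nlinarith)]
  have hQ0 : 0 < laguerrePotential (w ^ 6) β x := by nlinarith
  have h4 : w ^ 2 + (w ^ 6 - x ^ 2) ≤ 2 * laguerrePotential (w ^ 6) β x := by nlinarith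
  generalize laguerrePotential (w ^ 6) β x = q at *
  have hs := Real.sqrt_pos.2 hQ0
  have hsq := Real.sq_sqrt hQ0.le
  have h5 : √q * u x ^ 2 ≤ 30 * K := by
    refine le_of_mul_le_mul_right (a := √q) ?_ hs
    nlinarith
  have h6 : (√q * u x ^ 2) ^ 2 ≤ (30 * K) ^ 2 := by gcongr
  have h7 : (√q * u x ^ 2) ^ 2 = q * u x ^ 4 := by rw [mul_pow, hsq]; ring
  nlinarith [mul_le_mul_of_nonneg_left h4 (by positivity : 0 ≤ u x ^ 4)]

/-- Bound across the turning point. -/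
theorem sq_mul_le_turning {x : ℝ} (h : IsLaguerreSolution w β K a u v) (hx0 : 0 < x)
    (hx : w ^ 6 - 5 * w ^ 2 ≤ x ^ 2) (hx' : x ^ 2 ≤ w ^ 6 + 5 * w ^ 2) :
    u x ^ 2 * w ≤ 75 * Real.exp 70 * K := by
  have hw := h.ten_le
  have hw0 : 0 < w := by linarith
  have hw4 : (10 : ℝ) ^ 4 ≤ w ^ 4 := by gcongr
  have hw6 : w ^ 6 / 2 ≤ w ^ 6 - 5 * w ^ 2 := by nlinarith [sq_nonneg w]
  have hw3 : 0 < w ^ 3 := by positivity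
  have hw6p : 0 < w ^ 6 := by positivity
  have hK := h.K_nonneg
  set b := √(w ^ 6 - 5 * w ^ 2) with hb
  have hb2 : b ^ 2 = w ^ 6 - 5 * w ^ 2 := Real.sq_sqrt (by linarith)
  have hb0 : 0 < b := Real.sqrt_pos.2 (by linarith)
  have hbx : b ≤ x := by rw [hb, Real.sqrt_le_left hx0.le]; exact hx
  have hQ : ∀ y ∈ Set.Icc b x, |laguerrePotential (w ^ 6) β y| ≤ 6 * w ^ 2 := by
    intro y hy
    have hy0 : 0 < y := hb0.trans_le hy.1
    have h1 : w ^ 6 - 5 * w ^ 2 ≤ y ^ 2 := by nlinarith [hy.1]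
    have h2 : y ^ 2 ≤ w ^ 6 + 5 * w ^ 2 := by nlinarith [hy.2]
    have h3 := _root_.abs_le.1 (abs_laguerrePotential_sub_le hw h.abs_le (hw6.trans h1))
    rw [_root_.abs_le]
    constructor <;> nlinarith
  have hL : w * (x - b) ≤ 10 := by
    have h1 : w ^ 3 ≤ x + b := by
      rcases le_total (w ^ 3) x with h2 | h2
      · linarith
      · have : w ^ 3 / 2 ≤ b := Real.le_sqrt_of_sq_le (by nlinarith)
        linarith
    have h2 : (x - b) * (x + b) ≤ 10 * w ^ 2 := by nlinarith
    have h3 : (x - b) * w ^ 3 ≤ 10 * w ^ 2 := by nlinarith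
    have h4 : w * (x - b) * w ^ 2 ≤ 10 * w ^ 2 := by nlinarith
    exact le_of_mul_le_mul_right h4 (by positivity)
  have hmain := sq_add_sq_le_of_abs_le hbx hw0 hL
    (fun y hy => h.hu y (hb0.trans_le hy.1)) (fun y hy => h.hv y (hb0.trans_le hy.1)) hQ
  have hQb := hQ b (Set.left_mem_Icc.2 hbx)
  have hQb' := _root_.abs_le.1 (abs_laguerrePotential_sub_le hw h.abs_le (hw6.trans hb2.ge))
  have hGb := h.energy_le_sqrt hb0 (hw6.trans hb2.ge) hb2.le
  have hSb : √(laguerrePotential (w ^ 6) β b) ≤ 5 / 2 * w := by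
    rw [Real.sqrt_le_left (by positivity)]
    nlinarith [(_root_.abs_le.1 hQb).2]
  have h1 : w ^ 2 * u b ^ 2 + v b ^ 2 ≤ 75 * K * w := by
    unfold soninEnergy at hGb
    have h2 : w ^ 2 ≤ laguerrePotential (w ^ 6) β b := by nlinarith
    nlinarith [mul_le_mul_of_nonneg_right h2 (sq_nonneg (u b))]
  have he := Real.exp_pos 70
  have h2 : u x ^ 2 * w * w ≤ 75 * Real.exp 70 * K * w := by
    norm_num at hmain
    nlinarith [sq_nonneg (v x), mul_le_mul_of_nonneg_left h1 he.le]
  exact le_of_mul_le_mul_right h2 hw0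

theorem pow_four_mul_le_turning {x : ℝ} (h : IsLaguerreSolution w β K a u v) (hx0 : 0 < x)
    (hx : w ^ 6 - 5 * w ^ 2 ≤ x ^ 2) (hx' : x ^ 2 ≤ w ^ 6 + 5 * w ^ 2) :
    u x ^ 4 * (w ^ 2 + |w ^ 6 - x ^ 2|) ≤ 6 * (75 * Real.exp 70 * K) ^ 2 := by
  have h1 := h.sq_mul_le_turning hx0 hx hx'
  have hw0 : 0 < w := by linarith [h.ten_le]
  have h2 : |w ^ 6 - x ^ 2| ≤ 5 * w ^ 2 := _root_.abs_le.2 ⟨by linarith, by linarith⟩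
  have h3 : (u x ^ 2 * w) ^ 2 ≤ (75 * Real.exp 70 * K) ^ 2 := by gcongr
  nlinarith [mul_le_mul_of_nonneg_left h2 (by positivity : 0 ≤ u x ^ 4)]

theorem potential_le {x : ℝ} (h : IsLaguerreSolution w β K a u v)
    (hx : w ^ 6 + 5 * w ^ 2 ≤ x ^ 2) : 4 * w ^ 2 ≤ -laguerrePotential (w ^ 6) β x := by
  have hw := h.ten_le
  have h6 : 0 < w ^ 6 := by positivity
  have := (_root_.abs_le.1 (abs_laguerrePotential_sub_le hw h.abs_le
    (by nlinarith : w ^ 6 / 2 ≤ x ^ 2))).2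
  nlinarith

theorem mul_deriv_le {x : ℝ} (h : IsLaguerreSolution w β K a u v) (hx0 : 0 < x)
    (hx : w ^ 6 + 5 * w ^ 2 ≤ x ^ 2) :
    u x * v x ≤ -√(-laguerrePotential (w ^ 6) β x) * u x ^ 2 := by
  have hw := h.ten_le
  have h6 : 0 < w ^ 6 := by positivity
  have hle : ∀ y, x ≤ y → w ^ 6 + 5 * w ^ 2 ≤ y ^ 2 := fun y hy => by nlinarith
  refine mul_deriv_le_of_tendsto_zero (a := x)
    (fun y hy => hasDerivAt_laguerrePotential (w ^ 6) β (hx0.trans_le hy).ne')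
    (fun y hy => h.hu y (hx0.trans_le hy)) (fun y hy => h.hv y (hx0.trans_le hy))
    (fun y hy => by nlinarith [h.potential_le (hle y hy)]) (fun y hy => ?_)
    h.tendsto_energy h.tendsto_mul le_rfl
  have h1 : w ^ 6 / 2 ≤ y ^ 2 := by nlinarith [hle y hy]
  have h2 := (_root_.abs_le.1 (abs_two_mul_div_le_one hw h.abs_le (hx0.trans_le hy) h1)).2
  have h3 := one_le_of_le_sq hw (hx0.trans_le hy) h1
  linarith

theorem pow_four_mul_le_right {x : ℝ} (h : IsLaguerreSolution w β K a u v) (hx0 : 0 < x)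
    (hx : w ^ 6 + 5 * w ^ 2 ≤ x ^ 2) (hx' : x ^ 2 ≤ 3 * w ^ 6 / 2) :
    u x ^ 4 * (w ^ 2 + |w ^ 6 - x ^ 2|) ≤ 12 * (75 * Real.exp 70 * K) ^ 2 := by
  have hw := h.ten_le
  have hw0 : 0 < w := by linarith
  have hw3 : 0 < w ^ 3 := by positivity
  have hw6 : 0 < w ^ 6 := by positivity
  have hw3' : (1000 : ℝ) ≤ w ^ 3 := by
    calc (1000 : ℝ) = 10 ^ 3 := by norm_num
      _ ≤ w ^ 3 := by gcongr
  set b := √(w ^ 6 + 5 * w ^ 2) with hb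
  have hb2 : b ^ 2 = w ^ 6 + 5 * w ^ 2 := Real.sq_sqrt (by positivity)
  have hb0 : 0 < b := Real.sqrt_pos.2 (by positivity)
  have hbx : b ≤ x := by rw [hb, Real.sqrt_le_left hx0.le]; exact hx
  have hsq : ∀ y ∈ Set.Icc b x, 0 < y ∧ w ^ 6 + 5 * w ^ 2 ≤ y ^ 2 ∧ y ^ 2 ≤ 3 * w ^ 6 / 2 := by
    intro y hy
    have hy0 : 0 < y := hb0.trans_le hy.1
    refine ⟨hy0, ?_, ?_⟩ <;> nlinarith [hy.1, hy.2]
  have hmain := neg_mul_pow_four_le hbx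
    (fun y hy => hasDerivAt_laguerrePotential (w ^ 6) β (hsq y hy).1.ne')
    (fun y hy => h.hu y (hsq y hy).1)
    (fun y hy => by nlinarith [h.potential_le (hsq y hy).2.1])
    (fun y hy => by
      obtain ⟨h0, h1, h2⟩ := hsq y hy
      have h3 := (_root_.abs_le.1 (abs_two_mul_div_le_one hw h.abs_le h0
        (by nlinarith [sq_nonneg w] : w ^ 6 / 2 ≤ y ^ 2))).1
      have h4 : y ≤ 3 / 2 * w ^ 3 := by
        refine le_of_sq_le_sq ?_ (by positivity)
        nlinarith
      have h5 := h.potential_le h1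
      have h6 : 2 * w ≤ √(-laguerrePotential (w ^ 6) β y) :=
        Real.le_sqrt_of_sq_le (by linarith)
      have h7 : 4 * w ^ 2 * (2 * w) ≤ -laguerrePotential (w ^ 6) β y *
          √(-laguerrePotential (w ^ 6) β y) :=
        mul_le_mul h5 h6 (by positivity) (by nlinarith)
      nlinarith)
    (fun y hy => h.mul_deriv_le (hsq y hy).1 (hsq y hy).2.1)
  have h1 := h.pow_four_mul_le_turning hb0 (by nlinarith [sq_nonneg w]) hb2.le
  have h2 : |w ^ 6 - b ^ 2| = 5 * w ^ 2 := by
    rw [hb2, sub_add_cancel_left, abs_neg, abs_of_pos (by positivity)]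
  rw [h2] at h1
  have h3 := _root_.abs_le.1 (abs_laguerrePotential_sub_le hw h.abs_le
    (by nlinarith [sq_nonneg w] : w ^ 6 / 2 ≤ b ^ 2))
  have h4 := _root_.abs_le.1 (abs_laguerrePotential_sub_le hw h.abs_le
    (by nlinarith [sq_nonneg w] : w ^ 6 / 2 ≤ x ^ 2))
  have h5 : -laguerrePotential (w ^ 6) β b ≤ w ^ 2 + 5 * w ^ 2 := by nlinarith
  have h6 : |w ^ 6 - x ^ 2| = x ^ 2 - w ^ 6 := by
    rw [abs_of_nonpos (by nlinarith [sq_nonneg w])]; ring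
  rw [h6]
  have h7 : w ^ 2 + (x ^ 2 - w ^ 6) ≤ 2 * -laguerrePotential (w ^ 6) β x := by nlinarith
  nlinarith [mul_le_mul_of_nonneg_right h5 (by positivity : 0 ≤ u b ^ 4),
    mul_le_mul_of_nonneg_right h7 (by positivity : 0 ≤ u x ^ 4)]

/-- Bound in the transition region around the turning point. -/
theorem pow_four_mul_le {x : ℝ} (h : IsLaguerreSolution w β K a u v) (hx0 : 0 < x)
    (hx : w ^ 6 / 2 ≤ x ^ 2) (hxu : x ^ 2 ≤ 3 * w ^ 6 / 2) :
    u x ^ 4 * (w ^ 2 + |w ^ 6 - x ^ 2|) ≤ 12 * (75 * Real.exp 70 * K) ^ 2 := by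
  have hK := h.K_nonneg
  rcases le_total (x ^ 2) (w ^ 6 - 5 * w ^ 2) with h1 | h1
  · refine (h.pow_four_mul_le_left hx0 hx h1).trans ?_
    have : (75 * K) ^ 2 ≤ (75 * Real.exp 70 * K) ^ 2 := by
      have := Real.one_le_exp (by norm_num : (0 : ℝ) ≤ 70)
      gcongr
      linarith
    nlinarith [sq_nonneg K]
  · rcases le_total (x ^ 2) (w ^ 6 + 5 * w ^ 2) with h2 | h2
    · refine (h.pow_four_mul_le_turning hx0 h1 h2).trans ?_
      nlinarith [sq_nonneg (75 * Real.exp 70 * K)]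
    · exact h.pow_four_mul_le_right hx0 h2 hxu

/-- Gaussian bound beyond the transition region. -/
theorem sq_le_exp {x : ℝ} (h : IsLaguerreSolution w β K a u v) (hx0 : 0 < x)
    (hx : 3 * w ^ 6 / 2 ≤ x ^ 2) : u x ^ 2 ≤ 75 * Real.exp 70 * K * Real.exp (-x ^ 2 / 18) := by
  have hw := h.ten_le
  have hw6 : 0 < w ^ 6 := by positivity
  have hw4 : (10 : ℝ) ^ 4 ≤ w ^ 4 := by gcongr
  have hw6' : (10 : ℝ) ^ 6 ≤ w ^ 6 := by gcongr
  have hK := h.K_nonneg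
  set b := √(5 * w ^ 6 / 4) with hb
  have hb2 : b ^ 2 = 5 * w ^ 6 / 4 := Real.sq_sqrt (by positivity)
  have hb0 : 0 < b := Real.sqrt_pos.2 (by positivity)
  have hbx : b ≤ x := by rw [hb, Real.sqrt_le_left hx0.le]; linarith
  have hsq : ∀ y ∈ Set.Icc b x, 0 < y ∧ 5 * w ^ 6 / 4 ≤ y ^ 2 ∧ w ^ 6 + 5 * w ^ 2 ≤ y ^ 2 := by
    intro y hy
    have hy0 : 0 < y := hb0.trans_le hy.1
    have h1 : 5 * w ^ 6 / 4 ≤ y ^ 2 := by nlinarith [hy.1]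
    exact ⟨hy0, h1, by nlinarith [sq_nonneg w]⟩
  have hmain := sq_mul_exp_le hbx (fun y hy => h.hu y (hsq y hy).1)
    (Q := laguerrePotential (w ^ 6) β) (fun y hy => by
      obtain ⟨h0, h1, h2⟩ := hsq y hy
      have h3 := _root_.abs_le.1 (abs_laguerrePotential_sub_le hw h.abs_le
        (by nlinarith : w ^ 6 / 2 ≤ y ^ 2))
      exact Real.le_sqrt_of_sq_le (by nlinarith))
    (fun y hy => h.mul_deriv_le (hsq y hy).1 (hsq y hy).2.2)
  have h1 := h.pow_four_mul_le hb0 (by linarith) (by linarith)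
  have h2 : u b ^ 2 ≤ 75 * Real.exp 70 * K := by
    refine le_of_sq_le_sq ?_ (by positivity)
    have h3 : 12 ≤ w ^ 2 + |w ^ 6 - b ^ 2| := by nlinarith [abs_nonneg (w ^ 6 - b ^ 2)]
    nlinarith [mul_le_mul_of_nonneg_left h3 (by positivity : 0 ≤ u b ^ 4)]
  have h3 : Real.exp (b ^ 2 / 3) ≤ Real.exp (-x ^ 2 / 18) * Real.exp (x ^ 2 / 3) := by
    rw [← Real.exp_add, Real.exp_le_exp]
    linarith
  refine le_of_mul_le_mul_right ?_ (Real.exp_pos (x ^ 2 / 3))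
  calc u x ^ 2 * Real.exp (x ^ 2 / 3) ≤ u b ^ 2 * Real.exp (b ^ 2 / 3) := hmain
    _ ≤ 75 * Real.exp 70 * K * (Real.exp (-x ^ 2 / 18) * Real.exp (x ^ 2 / 3)) := by gcongr
    _ = _ := by ring

end IsLaguerreSolution

end Uniform

/-- The explicit form of the Laguerre polynomial. -/
noncomputable def laguerrePoly (k : ℕ) (δ : ℝ) : Polynomial ℝ :=
  ∑ j ∈ Finset.range (k + 1), Polynomial.C ((-1) ^ j * (k.choose j : ℝ) *
    (Real.Gamma (k + δ + 1) / (Real.Gamma (δ + j + 1) * (k.factorial : ℝ)))) * Polynomial.X ^ j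

theorem coeff_laguerrePoly (k : ℕ) (δ : ℝ) (j : ℕ) :
    (laguerrePoly k δ).coeff j = (-1) ^ j * (k.choose j : ℝ) *
      (Real.Gamma (k + δ + 1) / (Real.Gamma (δ + j + 1) * (k.factorial : ℝ))) := by
  unfold laguerrePoly
  simp only [Polynomial.finsetSum_coeff, Polynomial.coeff_C_mul_X_pow]
  rw [Finset.sum_ite_eq]
  split_ifs with h
  · rfl
  · rw [Nat.choose_eq_zero_of_lt (by simpa using h)]
    simp

theorem eval_laguerrePoly (k : ℕ) (δ t : ℝ) :
    (laguerrePoly k δ).eval t = ∑ j ∈ Finset.range (k + 1), (-1) ^ j * (k.choose j : ℝ) *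
      (Real.Gamma (k + δ + 1) / (Real.Gamma (δ + j + 1) * (k.factorial : ℝ))) * t ^ j := by
  simp [laguerrePoly, Polynomial.eval_finsetSum]

theorem laguerrePoly_ode (k : ℕ) {δ : ℝ} (hδ : -1 < δ) :
    Polynomial.X * Polynomial.derivative (Polynomial.derivative (laguerrePoly k δ)) +
      (Polynomial.C (δ + 1) - Polynomial.X) * Polynomial.derivative (laguerrePoly k δ) +
      Polynomial.C (k : ℝ) * laguerrePoly k δ = 0 := by
  have hrec : ∀ j : ℕ, (j + 1 : ℝ) * (δ + j + 1) * (laguerrePoly k δ).coeff (j + 1) =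
      (j - k : ℝ) * (laguerrePoly k δ).coeff j := by
    intro j
    have hpos : 0 < δ + j + 1 := by
      have : (0 : ℝ) ≤ j := j.cast_nonneg
      linarith
    have h1 : Real.Gamma (δ + (j + 1 : ℕ) + 1) = (δ + j + 1) * Real.Gamma (δ + j + 1) := by
      rw [← Real.Gamma_add_one hpos.ne']
      push_cast
      ring_nf
    have h2 : ((k.choose (j + 1) : ℕ) : ℝ) * (j + 1) = k.choose j * (k - j) := by
      rcases le_or_gt j k with h | h
      · have := Nat.choose_succ_right_eq k j
        rw [← Nat.cast_sub h]
        exact_mod_cast this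
      · rw [Nat.choose_eq_zero_of_lt h, Nat.choose_eq_zero_of_lt (h.trans j.lt_succ_self)]
        simp
    have hG := (Real.Gamma_pos_of_pos hpos).ne'
    have hk : (k.factorial : ℝ) ≠ 0 := by positivity
    rw [coeff_laguerrePoly, coeff_laguerrePoly, h1]
    field_simp
    rw [pow_succ]
    linear_combination (-(-1) ^ j * Real.Gamma (k + δ + 1)) * h2
  ext j
  rcases j with _ | j
  · have := hrec 0
    simp [sub_mul, Polynomial.coeff_derivative] at this ⊢
    linarith
  · have := hrec (j + 1)
    simp [sub_mul, add_mul, Polynomial.coeff_derivative] at this ⊢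
    linear_combination this

theorem eval_laguerrePoly_ode (k : ℕ) {δ : ℝ} (hδ : -1 < δ) (t : ℝ) :
    t * (Polynomial.derivative (Polynomial.derivative (laguerrePoly k δ))).eval t +
      (δ + 1 - t) * (Polynomial.derivative (laguerrePoly k δ)).eval t +
      k * (laguerrePoly k δ).eval t = 0 := by
  simpa using congrArg (Polynomial.eval t) (laguerrePoly_ode k hδ)

theorem descPochhammer_eval_mul_Gamma {a : ℝ} (i : ℕ) (ha : (i : ℝ) - 1 < a) :
    (descPochhammer ℝ i).eval a * Real.Gamma (a - i + 1) = Real.Gamma (a + 1) := by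
  induction i with
  | zero => simp
  | succ i ih =>
    push_cast at ha ⊢
    have h1 := ih (by linarith)
    rw [descPochhammer_succ_right, ← h1, Real.Gamma_add_one (s := a - i) (by linarith)]
    simp
    ring_nf

/-- Rodrigues' formula agrees with the explicit polynomial. -/
theorem laguerreL_eq_eval (k : ℕ) {δ τ : ℝ} (hδ : -1 < δ) (hτ : 0 < τ) :
    laguerreL k δ τ = (laguerrePoly k δ).eval τ := by
  have hexp : ∀ i : ℕ, iteratedDeriv i (fun s : ℝ => Real.exp (-s)) τ =
      (-1) ^ i * Real.exp (-τ) := by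
    intro i
    have h := congrFun (iteratedDeriv_exp_const_mul i (-1)) τ
    simpa using h
  have hrpow : ∀ i ∈ Finset.range (k + 1), iteratedDeriv (k - i) (fun s : ℝ => s ^ ((k : ℝ) + δ)) τ =
      Real.Gamma (k + δ + 1) / Real.Gamma (δ + i + 1) * (τ ^ i * τ ^ δ) := by
    intro i hi
    have hik : i ≤ k := Nat.lt_succ_iff.1 (Finset.mem_range.1 hi)
    have hi0 : (0 : ℝ) ≤ i := i.cast_nonneg
    have hpos : 0 < δ + i + 1 := by linarith
    have h := descPochhammer_eval_mul_Gamma (a := k + δ) (k - i) (by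
      rw [Nat.cast_sub hik]; linarith)
    rw [Nat.cast_sub hik, show (k : ℝ) + δ - (k - i) + 1 = δ + i + 1 by ring] at h
    rw [iteratedDeriv_eq_iterate, Real.iter_deriv_rpow_const, ← h,
      mul_div_cancel_right₀ _ (Real.Gamma_pos_of_pos hpos).ne', Nat.cast_sub hik,
      show (k : ℝ) + δ - (k - i) = i + δ by ring, Real.rpow_add hτ, Real.rpow_natCast]
  unfold laguerreL
  rw [iteratedDeriv_fun_mul (by fun_prop) (Real.contDiffAt_rpow_const (Or.inl hτ.ne')),
    eval_laguerrePoly, Finset.mul_sum]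
  refine Finset.sum_congr rfl fun i hi => ?_
  rw [hexp, hrpow i hi, Real.rpow_neg hτ.le, Real.exp_neg]
  have hi0 : (0 : ℝ) ≤ i := i.cast_nonneg
  have hG := (Real.Gamma_pos_of_pos (by linarith : 0 < δ + i + 1)).ne'
  have h1 := (Real.rpow_pos_of_pos hτ δ).ne'
  have h2 := (Real.exp_pos τ).ne'
  field_simp

theorem exists_pos_le_Gamma : ∃ g > (0 : ℝ), ∀ x : ℝ, 0 < x → g ≤ Real.Gamma x := by
  obtain ⟨x, hx, hmin⟩ := Real.exists_isMinOn_Gamma_Ioi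
  exact ⟨Real.Gamma x, Real.Gamma_pos_of_pos (by linarith [hx.1]), fun y hy => hmin hy⟩

theorem exists_abs_eval_laguerrePoly_le {δ : ℝ} (hδ : -1 < δ) :
    ∃ c > (0 : ℝ), ∀ (k : ℕ) (t : ℝ), 0 ≤ t → |(laguerrePoly k δ).eval t| ≤
      c * (Real.Gamma (k + δ + 1) / Real.Gamma (k + 1)) * Real.exp (k * t) := by
  obtain ⟨g, hg, hle⟩ := exists_pos_le_Gamma
  refine ⟨g⁻¹, inv_pos.2 hg, fun k t ht => ?_⟩
  have hk0 : (0 : ℝ) ≤ k := k.cast_nonneg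
  have hGk := Real.Gamma_pos_of_pos (by linarith : 0 < k + δ + 1)
  rw [Real.Gamma_nat_eq_factorial]
  have hexp : (t + 1) ^ k ≤ Real.exp (k * t) := by
    rw [Real.exp_nat_mul]
    gcongr
    exact Real.add_one_le_exp t
  calc |(laguerrePoly k δ).eval t|
      ≤ ∑ j ∈ Finset.range (k + 1), |(-1) ^ j * (k.choose j : ℝ) *
      (Real.Gamma (k + δ + 1) / (Real.Gamma (δ + j + 1) * (k.factorial : ℝ))) * t ^ j| := by
        rw [eval_laguerrePoly]; exact Finset.abs_sum_le_sum_abs _ _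
    _ ≤ ∑ j ∈ Finset.range (k + 1), g⁻¹ * (Real.Gamma (k + δ + 1) / k.factorial) *
          (t ^ j * 1 ^ (k - j) * (k.choose j : ℝ)) := by
        refine Finset.sum_le_sum fun j _ => ?_
        have hj0 : (0 : ℝ) ≤ j := j.cast_nonneg
        have hG := Real.Gamma_pos_of_pos (by linarith : 0 < δ + j + 1)
        have hG' := hle _ (by linarith : 0 < δ + j + 1)
        rw [abs_mul, abs_mul, abs_mul, abs_pow, abs_neg, abs_one, one_pow, one_mul, Nat.abs_cast,
          abs_of_nonneg (by positivity : 0 ≤ t ^ j), abs_of_pos (by positivity), one_pow, mul_one]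
        have h1 : Real.Gamma (k + δ + 1) / (Real.Gamma (δ + j + 1) * (k.factorial : ℝ)) ≤
            g⁻¹ * (Real.Gamma (k + δ + 1) / k.factorial) := by
          rw [inv_mul_eq_div, div_div, mul_comm (k.factorial : ℝ) g]
          gcongr
        calc (k.choose j : ℝ) * (Real.Gamma (k + δ + 1) /
              (Real.Gamma (δ + j + 1) * (k.factorial : ℝ))) * t ^ j
            ≤ (k.choose j : ℝ) * (g⁻¹ * (Real.Gamma (k + δ + 1) / k.factorial)) * t ^ j := by
              gcongr
          _ = _ := by ring
    _ = g⁻¹ * (Real.Gamma (k + δ + 1) / k.factorial) * (t + 1) ^ k := by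
        rw [← Finset.mul_sum, ← add_pow]
    _ ≤ _ := by gcongr

theorem rpow_le_rpow_add_rpow {s a b t : ℝ} (ha : 0 < a) (hat : a ≤ t) (htb : t ≤ b) :
    t ^ s ≤ a ^ s + b ^ s := by
  have ht : 0 < t := ha.trans_le hat
  have hb : 0 < b := ht.trans_le htb
  rcases le_total 0 s with hs | hs
  · linarith [Real.rpow_le_rpow ht.le htb hs, Real.rpow_nonneg ha.le s]
  · linarith [Real.rpow_le_rpow_of_nonpos ha hat hs, Real.rpow_nonneg hb.le s]

theorem exists_Gamma_ratio_le {δ : ℝ} (hδ : -1 < δ) :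
    ∃ c > (0 : ℝ), ∀ k : ℕ, Real.Gamma (k + δ + 1) / Real.Gamma (k + 1) ≤
      c * (4 * (k : ℝ) + 2 * δ + 2) ^ δ := by
  have hΓ := Real.Gamma_pos_of_pos (by linarith : 0 < δ + 1)
  have hprod : ∀ n : ℕ, Real.Gamma (δ + 1) * ∏ j ∈ Finset.range (n + 1), (δ + 1 + (j : ℝ)) =
      (n + δ + 1) * Real.Gamma (n + δ + 1) := by
    intro n
    induction n with
    | zero => simp; ring
    | succ n ih =>
      have hn : (0 : ℝ) ≤ n := n.cast_nonneg
      rw [Finset.prod_range_succ, ← mul_assoc, ih]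
      push_cast
      rw [show (n : ℝ) + 1 + δ + 1 = (n + δ + 1) + 1 by ring,
        Real.Gamma_add_one (by linarith : (0 : ℝ) < n + δ + 1).ne']
      ring
  obtain ⟨D, hD⟩ := ((Real.GammaSeq_tendsto_Gamma (δ + 1)).inv₀ hΓ.ne').bddAbove_range
  have hD' : ∀ n : ℕ, (Real.GammaSeq (δ + 1) n)⁻¹ ≤ D := fun n => hD ⟨n, rfl⟩
  set b : ℝ := (1 / (4 + 2 * (δ + 1))) ^ δ + (1 / 4) ^ δ with hb
  have hδ1 : 0 < δ + 1 := by linarith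
  have hb0 : 0 < b := by positivity
  refine ⟨Real.Gamma (δ + 1) * (2 * δ + 2) ^ (-δ) + Real.Gamma (δ + 1) * |D| * b, ?_, fun k => ?_⟩
  · have : 0 < (2 * δ + 2) ^ (-δ) := Real.rpow_pos_of_pos (by linarith) _
    positivity
  have h2δ : 0 < 2 * δ + 2 := by linarith
  rcases Nat.eq_zero_or_pos k with rfl | hk
  · simp only [Nat.cast_zero, mul_zero, zero_add, Real.Gamma_one, div_one]
    have h1 : (2 * δ + 2) ^ (-δ) * (2 * δ + 2) ^ δ = 1 := by
      rw [← Real.rpow_add h2δ]; simp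
    have h2 : 0 ≤ Real.Gamma (δ + 1) * |D| * b * (2 * δ + 2) ^ δ := by positivity
    nlinarith
  · have hk1 : (1 : ℝ) ≤ k := by exact_mod_cast hk
    have hk0 : (0 : ℝ) < k := by linarith
    have hν : 0 < 4 * (k : ℝ) + 2 * δ + 2 := by linarith
    have h1 : (k : ℝ) ^ δ ≤ b * (4 * (k : ℝ) + 2 * δ + 2) ^ δ := by
      have h2 : (k / (4 * (k : ℝ) + 2 * δ + 2)) ^ δ ≤ b := by
        refine rpow_le_rpow_add_rpow (by positivity) ?_ ?_
        · rw [div_le_div_iff₀ (by positivity) hν]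
          nlinarith
        · rw [div_le_div_iff₀ hν (by norm_num)]
          linarith
      rwa [Real.div_rpow hk0.le hν.le, div_le_iff₀ (by positivity)] at h2
    have h2 := (hD' k).trans (le_abs_self D)
    rw [Real.GammaSeq, inv_div, div_le_iff₀ (by positivity)] at h2
    have h3 := mul_le_mul_of_nonneg_left h2 hΓ.le
    rw [hprod, Real.rpow_add hk0, Real.rpow_one] at h3
    have h4 : Real.Gamma (k + δ + 1) ≤
        Real.Gamma (δ + 1) * |D| * (k : ℝ) ^ δ * k.factorial := by
      refine le_of_mul_le_mul_left (a := (k : ℝ) + δ + 1) ?_ (by linarith)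
      refine h3.trans ?_
      have h5 : 0 ≤ Real.Gamma (δ + 1) * |D| * (k : ℝ) ^ δ * k.factorial := by positivity
      nlinarith
    rw [Real.Gamma_nat_eq_factorial, div_le_iff₀ (by positivity)]
    have h5 : 0 ≤ Real.Gamma (δ + 1) * (2 * δ + 2) ^ (-δ) *
        (4 * (k : ℝ) + 2 * δ + 2) ^ δ := by positivity
    calc Real.Gamma (k + δ + 1) ≤ Real.Gamma (δ + 1) * |D| * (k : ℝ) ^ δ * k.factorial := h4
      _ ≤ Real.Gamma (δ + 1) * |D| * (b * (4 * (k : ℝ) + 2 * δ + 2) ^ δ) * k.factorial := by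
        gcongr
      _ ≤ _ := by
        nlinarith [mul_nonneg h5 (Nat.cast_nonneg (α := ℝ) k.factorial)]

theorem tendsto_rpow_mul_eval_mul_exp_neg (p : Polynomial ℝ) (s : ℝ) {b : ℝ} (hb : 0 < b) :
    Filter.Tendsto (fun t : ℝ => t ^ s * p.eval t * Real.exp (-b * t)) Filter.atTop (nhds 0) := by
  induction p using Polynomial.induction_on' with
  | add p q hp hq =>
    have h := hp.add hq
    rw [add_zero] at h
    refine h.congr fun t => ?_
    simp only [Polynomial.eval_add]
    ring
  | monomial n c =>
    have h := (tendsto_rpow_mul_exp_neg_mul_atTop_nhds_zero (s + n) b hb).const_mul c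
    rw [mul_zero] at h
    refine h.congr' ?_
    filter_upwards [Filter.eventually_gt_atTop 0] with t ht
    rw [Polynomial.eval_monomial, Real.rpow_add ht, Real.rpow_natCast]
    ring

theorem laguerreNorm_eq (k : ℕ) {δ τ : ℝ} (hδ : -1 < δ) (hτ : 0 < τ) :
    laguerreNorm k δ τ = √(Real.Gamma (k + 1) / Real.Gamma (k + δ + 1)) *
      Real.exp (-τ / 2) * τ ^ (δ / 2) * (laguerrePoly k δ).eval τ := by
  rw [laguerreNorm, laguerreL_eq_eval k hδ hτ]

/-- The Laguerre function in the variable `τ = x ^ 2`, in Liouville normal form. -/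
noncomputable def laguerreRadial (k : ℕ) (δ x : ℝ) : ℝ :=
  √(Real.Gamma (k + 1) / Real.Gamma (k + δ + 1)) *
    (Real.exp (-x ^ 2 / 2) * x ^ (δ + 1 / 2) * (laguerrePoly k δ).eval (x ^ 2))

/-- The derivative of `laguerreRadial`. -/
noncomputable def laguerreRadialDeriv (k : ℕ) (δ x : ℝ) : ℝ :=
  √(Real.Gamma (k + 1) / Real.Gamma (k + δ + 1)) *
    (Real.exp (-x ^ 2 / 2) * x ^ (δ + 1 / 2) *
      (((δ + 1 / 2) / x - x) * (laguerrePoly k δ).eval (x ^ 2) +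
        2 * x * (Polynomial.derivative (laguerrePoly k δ)).eval (x ^ 2)))

theorem laguerreRadial_eq (k : ℕ) {δ x : ℝ} (hδ : -1 < δ) (hx : 0 < x) :
    laguerreRadial k δ x = √x * laguerreNorm k δ (x ^ 2) := by
  rw [laguerreNorm_eq k hδ (by positivity), laguerreRadial, Real.rpow_add hx,
    ← Real.sqrt_eq_rpow, ← Real.rpow_natCast_mul hx.le]
  rw [show ((2 : ℕ) : ℝ) * (δ / 2) = δ by push_cast; ring]
  ring

theorem hasDerivAt_exp_mul_rpow (s : ℝ) {x : ℝ} (hx : 0 < x) :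
    HasDerivAt (fun y : ℝ => Real.exp (-y ^ 2 / 2) * y ^ s)
      (Real.exp (-x ^ 2 / 2) * x ^ s * (s / x - x)) x := by
  have h1 : HasDerivAt (fun y : ℝ => -y ^ 2 / 2) (-x) x := by
    refine ((hasDerivAt_pow 2 x).neg.div_const 2).congr_deriv ?_
    simp
    ring
  refine (h1.exp.mul (Real.hasDerivAt_rpow_const (Or.inl hx.ne'))).congr_deriv ?_
  rw [Real.rpow_sub_one hx.ne']
  field_simp
  ring

theorem hasDerivAt_eval_sq (p : Polynomial ℝ) (x : ℝ) :
    HasDerivAt (fun y : ℝ => p.eval (y ^ 2)) (2 * x * (Polynomial.derivative p).eval (x ^ 2)) x := by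
  refine ((p.hasDerivAt (x ^ 2)).comp x (hasDerivAt_pow 2 x)).congr_deriv ?_
  simp
  ring

theorem hasDerivAt_laguerreRadial (k : ℕ) (δ : ℝ) {x : ℝ} (hx : 0 < x) :
    HasDerivAt (laguerreRadial k δ) (laguerreRadialDeriv k δ x) x := by
  refine (((hasDerivAt_exp_mul_rpow (δ + 1 / 2) hx).mul
    (hasDerivAt_eval_sq (laguerrePoly k δ) x)).const_mul _).congr_deriv ?_
  rw [laguerreRadialDeriv]
  ring

theorem hasDerivAt_laguerreRadialDeriv (k : ℕ) {δ x : ℝ} (hδ : -1 < δ) (hx : 0 < x) :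
    HasDerivAt (laguerreRadialDeriv k δ)
      (-laguerrePotential (4 * k + 2 * δ + 2) (δ ^ 2 - 1 / 4) x * laguerreRadial k δ x) x := by
  have h1 : HasDerivAt (fun y : ℝ => (δ + 1 / 2) / y - y) (-(δ + 1 / 2) / x ^ 2 - 1) x := by
    refine (((hasDerivAt_const x (δ + 1 / 2)).div (hasDerivAt_id' x) hx.ne').sub
      (hasDerivAt_id' x)).congr_deriv ?_
    simp
  have h2 := (h1.mul (hasDerivAt_eval_sq (laguerrePoly k δ) x)).add
    (((hasDerivAt_id' x).const_mul 2).mul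
      (hasDerivAt_eval_sq (Polynomial.derivative (laguerrePoly k δ)) x))
  refine (((hasDerivAt_exp_mul_rpow (δ + 1 / 2) hx).mul h2).const_mul
    (√(Real.Gamma (k + 1) / Real.Gamma (k + δ + 1)))).congr_deriv ?_
  have hode := eval_laguerrePoly_ode k hδ (x ^ 2)
  simp only [Pi.add_apply, Pi.mul_apply]
  rw [laguerreRadial, laguerrePotential]
  field_simp
  linear_combination
    (64 * √(Real.Gamma (k + 1) / Real.Gamma (k + δ + 1)) * x ^ 2) * hode

theorem tendsto_rpow_mul_eval_sq_mul_exp (p : Polynomial ℝ) (s : ℝ) :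
    Filter.Tendsto (fun x : ℝ => x ^ s * p.eval (x ^ 2) * Real.exp (-x ^ 2 / 2))
      Filter.atTop (nhds 0) := by
  have h := (tendsto_rpow_mul_eval_mul_exp_neg p (s / 2) (b := 1 / 2) (by norm_num)).comp
    (Filter.tendsto_pow_atTop (α := ℝ) two_ne_zero)
  refine h.congr' ?_
  filter_upwards [Filter.eventually_gt_atTop 0] with x hx
  simp only [Function.comp_apply]
  rw [← Real.rpow_natCast_mul hx.le]
  rw [show ((2 : ℕ) : ℝ) * (s / 2) = s by push_cast; ring]
  ring_nf

theorem tendsto_mul_laguerreRadial (k : ℕ) (δ : ℝ) :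
    Filter.Tendsto (fun x => x * laguerreRadial k δ x) Filter.atTop (nhds 0) := by
  have h := (tendsto_rpow_mul_eval_sq_mul_exp (laguerrePoly k δ) (δ + 1 / 2 + 1)).const_mul
    (√(Real.Gamma (k + 1) / Real.Gamma (k + δ + 1)))
  rw [mul_zero] at h
  refine h.congr' ?_
  filter_upwards [Filter.eventually_gt_atTop 0] with x hx
  rw [laguerreRadial, Real.rpow_add_one hx.ne']
  ring

theorem tendsto_laguerreRadialDeriv (k : ℕ) (δ : ℝ) :
    Filter.Tendsto (laguerreRadialDeriv k δ) Filter.atTop (nhds 0) := by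
  have h1 := (tendsto_rpow_mul_eval_sq_mul_exp (laguerrePoly k δ)
    (δ + 1 / 2 - 1)).const_mul (δ + 1 / 2)
  have h2 := tendsto_rpow_mul_eval_sq_mul_exp (laguerrePoly k δ) (δ + 1 / 2 + 1)
  have h3 := (tendsto_rpow_mul_eval_sq_mul_exp (Polynomial.derivative (laguerrePoly k δ))
    (δ + 1 / 2 + 1)).const_mul 2
  have h := ((h1.sub h2).add h3).const_mul (√(Real.Gamma (k + 1) / Real.Gamma (k + δ + 1)))
  simp only [mul_zero, sub_zero, add_zero] at h
  refine h.congr' ?_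
  filter_upwards [Filter.eventually_gt_atTop 0] with x hx
  rw [laguerreRadialDeriv, Real.rpow_add_one hx.ne', Real.rpow_sub_one hx.ne']
  field_simp

theorem tendsto_laguerreRadial (k : ℕ) (δ : ℝ) :
    Filter.Tendsto (laguerreRadial k δ) Filter.atTop (nhds 0) := by
  have h := (tendsto_mul_laguerreRadial k δ).mul tendsto_inv_atTop_zero
  rw [mul_zero] at h
  refine h.congr' ?_
  filter_upwards [Filter.eventually_gt_atTop 0] with x hx
  field_simp

theorem tendsto_soninEnergy_laguerreRadial (k : ℕ) (δ ν β : ℝ) :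
    Filter.Tendsto (soninEnergy (laguerrePotential ν β) (laguerreRadial k δ)
      (laguerreRadialDeriv k δ)) Filter.atTop (nhds 0) := by
  have h0 := tendsto_laguerreRadial k δ
  have h1 := tendsto_mul_laguerreRadial k δ
  have hi : Filter.Tendsto (fun x : ℝ => x⁻¹ * laguerreRadial k δ x) Filter.atTop (nhds 0) := by
    simpa using tendsto_inv_atTop_zero.mul h0
  have h := ((((h0.pow 2).const_mul ν).sub (h1.pow 2)).sub ((hi.pow 2).const_mul β)).add
    ((tendsto_laguerreRadialDeriv k δ).pow 2)
  simp only [ne_eq, OfNat.ofNat_ne_zero, not_false_eq_true, zero_pow, mul_zero, sub_zero,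
    add_zero] at h
  refine h.congr' ?_
  filter_upwards [Filter.eventually_gt_atTop 0] with x hx
  rw [soninEnergy, laguerrePotential]
  field_simp

/-- The spectral parameter of the Laguerre function of degree `k` and type `δ` is positive. -/
theorem spectral_pos (k : ℕ) {δ : ℝ} (hδ : -1 < δ) : 0 < 4 * (k : ℝ) + 2 * δ + 2 := by
  have : (0 : ℝ) ≤ k := k.cast_nonneg
  linarith

theorem exists_abs_laguerreNorm_le_rpow {δ : ℝ} (hδ : -1 < δ) (M : ℝ) :
    ∃ C > 0, ∀ (k : ℕ) (τ : ℝ), 0 < τ → τ * (4 * (k : ℝ) + 2 * δ + 2) ≤ M →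
      |laguerreNorm k δ τ| ≤ C * (τ * (4 * (k : ℝ) + 2 * δ + 2)) ^ (δ / 2) := by
  obtain ⟨c, hc, hp⟩ := exists_abs_eval_laguerrePoly_le hδ
  obtain ⟨d, hd, hr⟩ := exists_Gamma_ratio_le hδ
  refine ⟨√d * c * Real.exp M, by positivity, fun k τ hτ hM => ?_⟩
  have hk : (0 : ℝ) ≤ k := k.cast_nonneg
  have hν := spectral_pos k hδ
  have hG : 0 < Real.Gamma (k + δ + 1) := Real.Gamma_pos_of_pos (by linarith)
  have hG' : 0 < Real.Gamma (k + 1) := Real.Gamma_pos_of_pos (by linarith)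
  have hkM : k * τ ≤ M := by nlinarith
  have hNr : √(Real.Gamma (k + 1) / Real.Gamma (k + δ + 1)) *
      (Real.Gamma (k + δ + 1) / Real.Gamma (k + 1)) ≤
      √d * (4 * (k : ℝ) + 2 * δ + 2) ^ (δ / 2) := by
    have h1 : √(Real.Gamma (k + 1) / Real.Gamma (k + δ + 1)) *
        (Real.Gamma (k + δ + 1) / Real.Gamma (k + 1)) =
        √(Real.Gamma (k + δ + 1) / Real.Gamma (k + 1)) := by
      rw [← inv_div, Real.sqrt_inv, inv_mul_eq_div, Real.div_sqrt]
    rw [h1]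
    refine (Real.sqrt_le_sqrt (hr k)).trans_eq ?_
    rw [Real.sqrt_mul hd.le, Real.sqrt_eq_rpow ((_ : ℝ) ^ δ), ← Real.rpow_mul hν.le]
    ring_nf
  rw [laguerreNorm_eq k hδ hτ, Real.mul_rpow hτ.le hν.le, abs_mul,
    abs_of_nonneg (by positivity)]
  calc _ ≤ √(Real.Gamma (k + 1) / Real.Gamma (k + δ + 1)) * 1 * τ ^ (δ / 2) *
        (c * (Real.Gamma (k + δ + 1) / Real.Gamma (k + 1)) * Real.exp M) := by
        gcongr
        · exact Real.exp_le_one_iff.2 (by linarith)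
        · refine (hp k τ hτ.le).trans ?_
          gcongr
    _ = (√(Real.Gamma (k + 1) / Real.Gamma (k + δ + 1)) *
        (Real.Gamma (k + δ + 1) / Real.Gamma (k + 1))) * (τ ^ (δ / 2) * c * Real.exp M) := by ring
    _ ≤ √d * (4 * (k : ℝ) + 2 * δ + 2) ^ (δ / 2) * (τ ^ (δ / 2) * c * Real.exp M) := by gcongr
    _ = _ := by ring

theorem continuous_laguerreNorm_zero (k : ℕ) : Continuous (laguerreNorm k 0) := by
  have h : Continuous (iteratedDeriv k fun s : ℝ => Real.exp (-s) * s ^ ((k : ℝ) + 0)) := by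
    simp only [add_zero, Real.rpow_natCast]
    have hc : ContDiff ℝ k fun s : ℝ => Real.exp (-s) * s ^ k := by fun_prop
    exact hc.continuous_iteratedDeriv k le_rfl
  unfold laguerreNorm laguerreL
  simp only [neg_zero, zero_div, Real.rpow_zero]
  fun_prop

theorem exists_abs_laguerreNorm_le_rpow_of_nonneg {δ : ℝ} (hδ : -1 < δ) :
    ∃ C > 0, ∀ (k : ℕ) (τ : ℝ), 0 ≤ τ → τ ≤ 1 / (4 * (k : ℝ) + 2 * δ + 2) →
      |laguerreNorm k δ τ| ≤ C * (τ * (4 * (k : ℝ) + 2 * δ + 2)) ^ (δ / 2) := by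
  obtain ⟨C, hC, h⟩ := exists_abs_laguerreNorm_le_rpow hδ 1
  refine ⟨C, hC, fun k τ hτ hτ' => ?_⟩
  have hν := spectral_pos k hδ
  rcases hτ.eq_or_lt with rfl | hτ
  · rcases eq_or_ne δ 0 with rfl | hne
    · have ht : Filter.Tendsto (fun τ => |laguerreNorm k 0 τ|) (nhdsWithin 0 (Set.Ioi 0))
          (nhds |laguerreNorm k 0 0|) :=
        ((continuous_laguerreNorm_zero k).abs.tendsto 0).mono_left nhdsWithin_le_nhds
      refine le_of_tendsto ht ?_
      filter_upwards [Ioo_mem_nhdsGT (show 0 < 1 / (4 * (k : ℝ) + 2 * 0 + 2) by positivity)]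
        with t ht
      simpa using h k t ht.1 ((le_div_iff₀ hν).1 ht.2.le)
    · rw [laguerreNorm, Real.zero_rpow (by simpa using hne)]
      simp only [mul_zero, zero_mul, abs_zero]
      positivity
  · exact h k τ hτ ((le_div_iff₀ hν).1 hτ')

theorem exists_abs_laguerreNorm_le_rpow_neg {δ : ℝ} (hδ : -1 < δ) (M : ℝ) :
    ∃ C > 0, ∀ (k : ℕ) (τ : ℝ), 0 < τ → 1 ≤ τ * (4 * (k : ℝ) + 2 * δ + 2) →
      τ * (4 * (k : ℝ) + 2 * δ + 2) ≤ M →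
      |laguerreNorm k δ τ| ≤ C * (τ * (4 * (k : ℝ) + 2 * δ + 2)) ^ (-(1 : ℝ) / 4) := by
  obtain ⟨C, hC, h⟩ := exists_abs_laguerreNorm_le_rpow hδ M
  refine ⟨C * (1 + |M ^ (δ / 2 + 1 / 4)|), by positivity, fun k τ hτ h1 hM => ?_⟩
  refine (h k τ hτ hM).trans ?_
  rw [mul_assoc]
  gcongr
  set y := τ * (4 * (k : ℝ) + 2 * δ + 2)
  have hy : 0 < y := by linarith
  calc y ^ (δ / 2) = y ^ (δ / 2 + 1 / 4) * y ^ (-(1 : ℝ) / 4) := by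
        rw [← Real.rpow_add hy]
        ring_nf
    _ ≤ _ := by
        gcongr
        refine (rpow_le_rpow_add_rpow one_pos h1 hM).trans ?_
        rw [Real.one_rpow]
        gcongr
        exact le_abs_self _

theorem abs_le_mul_rpow_iff {x w C L : ℝ} (hx : 0 < x) (hw : 0 < w) (hC : 0 ≤ C) :
    |L| ≤ C * (x ^ 2 * w ^ 6) ^ (-(1 : ℝ) / 4) ↔ (√x * L) ^ 2 * w ^ 3 ≤ C ^ 2 := by
  set s := (x ^ 2 * w ^ 6) ^ (-(1 : ℝ) / 4) with hs
  have hs0 : 0 < s := by positivity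
  have hs2 : s ^ 2 * (x * w ^ 3) = 1 := by
    rw [hs, ← Real.rpow_mul_natCast (by positivity), show x ^ 2 * w ^ 6 = (x * w ^ 3) ^ 2 by ring,
      ← Real.rpow_natCast_mul (by positivity)]
    rw [show ((2 : ℕ) : ℝ) * (-1 / 4 * (2 : ℕ)) = -1 by push_cast; norm_num, Real.rpow_neg_one]
    exact inv_mul_cancel₀ (by positivity)
  have hxw : 0 < x * w ^ 3 := by positivity
  rw [mul_pow, Real.sq_sqrt hx.le]
  rw [show x * L ^ 2 * w ^ 3 = L ^ 2 * (x * w ^ 3) by ring]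
  rw [show C ^ 2 = (C * s) ^ 2 * (x * w ^ 3) by rw [mul_pow, mul_assoc, hs2, mul_one],
    mul_le_mul_iff_left₀ hxw, sq_le_sq, abs_of_nonneg (a := C * s) (by positivity)]

theorem abs_le_mul_rpow_mul_rpow {L D b c : ℝ} (hD : 0 ≤ D) (hb : 0 < b) (hc : 0 < c)
    (h : L ^ 4 * b * c ≤ D ^ 4) :
    |L| ≤ D * b ^ (-(1 : ℝ) / 4) * c ^ (-(1 : ℝ) / 4) := by
  refine le_of_pow_le_pow_left₀ (n := 4) (by norm_num) (by positivity) ?_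
  have key : ∀ y : ℝ, 0 < y → (y ^ (-(1 : ℝ) / 4)) ^ 4 = y⁻¹ := by
    intro y hy
    rw [← Real.rpow_mul_natCast hy.le]
    rw [show -(1 : ℝ) / 4 * (4 : ℕ) = -1 by push_cast; norm_num, Real.rpow_neg_one]
  rw [mul_pow, mul_pow, key b hb, key c hc, Even.pow_abs (by decide), ← div_eq_mul_inv,
    ← div_eq_mul_inv, le_div_iff₀ hc, le_div_iff₀ hb]
  linarith

theorem exists_soninEnergy_le {u v : ℝ → ℝ} {w β M C : ℝ} (hw : 0 < w) (hM1 : 1 ≤ M)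
    (hβM : |β| ≤ M) (hu : ∀ x, 0 < x → HasDerivAt u (v x) x)
    (hbound : ∀ x, M ≤ x * w ^ 3 → x * w ^ 3 ≤ 2 * M → u x ^ 2 * w ^ 3 ≤ C ^ 2) :
    ∃ a, 0 < a ∧ M ≤ a * w ^ 3 ∧ a * w ^ 3 ≤ 2 * M ∧
      soninEnergy (laguerrePotential (w ^ 6) β) u v a ≤ 6 * C ^ 2 * w ^ 3 := by
  have hW0 : 0 < w ^ 3 := by positivity
  have hpos : 0 < M / w ^ 3 := by positivity
  have hlt : M / w ^ 3 < 2 * M / w ^ 3 := by gcongr; linarith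
  obtain ⟨a, ⟨ha1, ha2⟩, hslope⟩ := exists_hasDerivAt_eq_slope u v hlt
    (fun x hx => (hu x (hpos.trans_le hx.1)).continuousAt.continuousWithinAt)
    (fun x hx => hu x (hpos.trans hx.1))
  have ha0 : 0 < a := hpos.trans ha1
  rw [div_lt_iff₀ hW0] at ha1
  rw [lt_div_iff₀ hW0] at ha2
  refine ⟨a, ha0, ha1.le, ha2.le, ?_⟩
  have e0 := hbound a ha1.le ha2.le
  have e1 := hbound (M / w ^ 3) (by rw [div_mul_cancel₀ _ hW0.ne'])
    (by rw [div_mul_cancel₀ _ hW0.ne']; linarith)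
  have e2 := hbound (2 * M / w ^ 3) (by rw [div_mul_cancel₀ _ hW0.ne']; linarith)
    (by rw [div_mul_cancel₀ _ hW0.ne'])
  have hv : v a ^ 2 ≤ 4 * C ^ 2 * w ^ 3 := by
    have h1 : v a * M = (u (2 * M / w ^ 3) - u (M / w ^ 3)) * w ^ 3 := by
      rw [hslope]
      field_simp
      ring
    have h2 : (u (2 * M / w ^ 3) - u (M / w ^ 3)) ^ 2 * w ^ 3 ≤ 4 * C ^ 2 := by
      linarith [mul_nonneg (sq_nonneg (u (2 * M / w ^ 3) + u (M / w ^ 3))) hW0.le]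
    calc v a ^ 2 ≤ v a ^ 2 * M ^ 2 :=
          le_mul_of_one_le_right (sq_nonneg _) (one_le_pow₀ hM1)
      _ = ((u (2 * M / w ^ 3) - u (M / w ^ 3)) ^ 2 * w ^ 3) * w ^ 3 := by
          rw [← mul_pow, h1]; ring
      _ ≤ _ := by gcongr
  have hQ : laguerrePotential (w ^ 6) β a ≤ 2 * w ^ 6 := by
    have h1 : -β / a ^ 2 ≤ w ^ 6 := by
      rw [div_le_iff₀ (by positivity)]
      calc -β ≤ |β| := neg_le_abs β
        _ ≤ M := hβM
        _ ≤ M ^ 2 := le_self_pow₀ hM1 two_ne_zero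
        _ ≤ (a * w ^ 3) ^ 2 := by gcongr
        _ = w ^ 6 * a ^ 2 := by ring
    rw [laguerrePotential]
    have h2 : β / a ^ 2 = -(-β / a ^ 2) := by ring
    linarith [sq_nonneg a]
  rw [soninEnergy]
  calc _ ≤ 2 * w ^ 6 * u a ^ 2 + 4 * C ^ 2 * w ^ 3 := by gcongr
    _ = 2 * (u a ^ 2 * w ^ 3) * w ^ 3 + 4 * C ^ 2 * w ^ 3 := by ring
    _ ≤ 2 * C ^ 2 * w ^ 3 + 4 * C ^ 2 * w ^ 3 := by gcongr
    _ = _ := by ring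

theorem exists_isLaguerreSolution {δ : ℝ} (hδ : -1 < δ) :
    ∃ (M K : ℝ) (k₀ : ℕ), ∀ k ≥ k₀, ∃ w a : ℝ, w ^ 6 = 4 * (k : ℝ) + 2 * δ + 2 ∧
      a ^ 2 * w ^ 6 ≤ M ∧ IsLaguerreSolution w (δ ^ 2 - 1 / 4) K a
        (laguerreRadial k δ) (laguerreRadialDeriv k δ) := by
  set β := δ ^ 2 - 1 / 4 with hβ
  obtain ⟨M, hM⟩ : ∃ M, M = 1 + 4 * |β| := ⟨_, rfl⟩
  have hβ0 := abs_nonneg β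
  have hM1 : 1 ≤ M := by linarith
  obtain ⟨C, hC, hsmall⟩ := exists_abs_laguerreNorm_le_rpow_neg hδ (4 * M ^ 2)
  refine ⟨4 * M ^ 2, 6 * C ^ 2, ⌈(10 + 8 * M ^ 2) ^ 6⌉₊, fun k hk => ?_⟩
  have hν := spectral_pos k hδ
  have hk' : (10 + 8 * M ^ 2) ^ 6 ≤ 4 * (k : ℝ) + 2 * δ + 2 := by
    have h1 := (Nat.le_ceil ((10 + 8 * M ^ 2) ^ 6)).trans (Nat.cast_le.2 hk)
    have : (0 : ℝ) ≤ k := k.cast_nonneg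
    linarith
  obtain ⟨w, hw0, hw⟩ : ∃ w : ℝ, 0 ≤ w ∧ w ^ 6 = 4 * (k : ℝ) + 2 * δ + 2 :=
    ⟨(4 * (k : ℝ) + 2 * δ + 2) ^ (1 / 6 : ℝ), by positivity, by
      rw [← Real.rpow_mul_natCast hν.le]
      norm_num⟩
  rw [← hw] at hk'
  have hwM : 10 + 8 * M ^ 2 ≤ w := le_of_pow_le_pow_left₀ (by norm_num) hw0 hk'
  have hMM : M ≤ M ^ 2 := le_self_pow₀ hM1 two_ne_zero
  have hw10 : 10 ≤ w := by linarith [sq_nonneg M]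
  have hW0 : 0 < w ^ 3 := by positivity
  have hsq : ∀ x, x ^ 2 * w ^ 6 = (x * w ^ 3) ^ 2 := fun x => by ring
  have hu : ∀ x, 0 < x → HasDerivAt (laguerreRadial k δ) (laguerreRadialDeriv k δ x) x :=
    fun x hx => hasDerivAt_laguerreRadial k δ hx
  obtain ⟨a, ha0, ha1, ha2, hE⟩ := exists_soninEnergy_le (β := β) (by linarith) hM1
    (by linarith) hu (C := C) (w := w) (by
      intro x h1 h2
      have hx : 0 < x := pos_of_mul_pos_left (by linarith) hW0.le
      rw [laguerreRadial_eq k hδ hx, ← abs_le_mul_rpow_iff hx (by linarith) hC.le, hw]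
      refine hsmall k _ (by positivity) ?_ ?_ <;> rw [← hw, hsq]
      · exact one_le_pow₀ (hM1.trans h1)
      · calc (x * w ^ 3) ^ 2 ≤ (2 * M) ^ 2 := by gcongr
          _ = 4 * M ^ 2 := by ring)
  have hM2 : a ^ 2 * w ^ 6 ≤ 4 * M ^ 2 := by
    rw [hsq]
    calc (a * w ^ 3) ^ 2 ≤ (2 * M) ^ 2 := by gcongr
      _ = 4 * M ^ 2 := by ring
  have hM3 : M ^ 2 ≤ a ^ 2 * w ^ 6 := by
    rw [hsq]
    gcongr
  refine ⟨w, a, hw, hM2, hw10, by linarith, ha0, by linarith, ?_, hu, fun x hx => ?_, hE,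
    tendsto_soninEnergy_laguerreRadial k δ _ _, ?_⟩
  · have h1 : w ≤ w ^ 6 := le_self_pow₀ (by linarith) (by norm_num)
    have h2 : a ^ 2 * 1 ≤ a ^ 2 * w ^ 6 := by
      gcongr
      linarith
    linarith
  · rw [hw]
    exact hasDerivAt_laguerreRadialDeriv k hδ hx
  · simpa using (tendsto_laguerreRadial k δ).mul (tendsto_laguerreRadialDeriv k δ)

/-- The bounds on the Laguerre function of degree `k` and type `δ` in the oscillatory, turning
point and exponential regions, with constant `C`. -/
def LaguerreBounds (C δ : ℝ) (k : ℕ) : Prop :=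
  ∀ τ : ℝ,
    (1 / (4 * (k : ℝ) + 2 * δ + 2) ≤ τ → τ ≤ (4 * (k : ℝ) + 2 * δ + 2) / 2 →
      |laguerreNorm k δ τ| ≤ C * (τ * (4 * (k : ℝ) + 2 * δ + 2)) ^ (-(1 : ℝ) / 4)) ∧
    ((4 * (k : ℝ) + 2 * δ + 2) / 2 ≤ τ → τ ≤ 3 * (4 * (k : ℝ) + 2 * δ + 2) / 2 →
      |laguerreNorm k δ τ| ≤ C * (4 * (k : ℝ) + 2 * δ + 2) ^ (-(1 : ℝ) / 4) *
        ((4 * (k : ℝ) + 2 * δ + 2) ^ ((1 : ℝ) / 3) +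
          |4 * (k : ℝ) + 2 * δ + 2 - τ|) ^ (-(1 : ℝ) / 4)) ∧
    (3 * (4 * (k : ℝ) + 2 * δ + 2) / 2 ≤ τ → |laguerreNorm k δ τ| ≤ C * Real.exp (-(1 / 36) * τ))

theorem LaguerreBounds.mono {C C' δ : ℝ} {k : ℕ} (hδ : -1 < δ) (h : LaguerreBounds C δ k)
    (hC : C ≤ C') : LaguerreBounds C' δ k := by
  have hν := spectral_pos k hδ
  intro τ
  obtain ⟨h2, h3, h4⟩ := h τ
  refine ⟨fun a b => (h2 a b).trans ?_, fun a b => (h3 a b).trans ?_, fun a => (h4 a).trans ?_⟩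
  · have hτ : 0 < τ := lt_of_lt_of_le (by positivity) a
    gcongr
  · gcongr
  · gcongr

theorem exists_laguerreBounds_of_ge {δ : ℝ} (hδ : -1 < δ) :
    ∃ (C : ℝ) (k₀ : ℕ), ∀ k ≥ k₀, LaguerreBounds C δ k := by
  obtain ⟨M, K, k₀, hsol⟩ := exists_isLaguerreSolution hδ
  obtain ⟨C, hC, hsmall⟩ := exists_abs_laguerreNorm_le_rpow_neg hδ M
  set B := 12 * (75 * Real.exp 70 * K) ^ 2 with hB
  have hB0 : 0 ≤ B := by positivity
  set A := 75 * Real.exp 70 * K with hA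
  refine ⟨C + √(12 * K) + (2 * B + 1) + √A, k₀, fun k hk τ => ?_⟩
  have hν := spectral_pos k hδ
  obtain ⟨w, a, hw, haM, h⟩ := hsol k hk
  have hK := h.K_nonneg
  have hA0 : 0 ≤ A := by positivity
  have hw10 := h.ten_le
  have hrad : 0 < τ → laguerreRadial k δ (√τ) = √(√τ) * laguerreNorm k δ τ := by
    intro hτ
    rw [laguerreRadial_eq k hδ (Real.sqrt_pos.2 hτ), Real.sq_sqrt hτ.le]
  refine ⟨fun h1 h2 => ?_, fun h1 h2 => ?_, fun h1 => ?_⟩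
  · have hτ : 0 < τ := lt_of_lt_of_le (by positivity) h1
    have hx : 0 < √τ := Real.sqrt_pos.2 hτ
    have hx2 : √τ ^ 2 = τ := Real.sq_sqrt hτ.le
    rcases le_total a (√τ) with hax | hax
    · have h3 := h.sq_mul_le hax (by rw [hx2, hw]; exact h2)
      rw [hrad hτ, ← Real.sq_sqrt (show 0 ≤ 12 * K by positivity),
        ← abs_le_mul_rpow_iff hx (by linarith) (Real.sqrt_nonneg _), hx2, hw] at h3
      refine h3.trans ?_
      gcongr
      linarith [Real.sqrt_nonneg A]
    · have h3 : τ ≤ a ^ 2 := by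
        rw [← hx2]
        gcongr
      refine (hsmall k τ hτ ((div_le_iff₀ hν).1 h1) ?_).trans ?_
      · refine le_trans ?_ haM
        rw [hw]
        gcongr
      · gcongr
        linarith [Real.sqrt_nonneg A, Real.sqrt_nonneg (12 * K)]
  · have hτ : 0 < τ := lt_of_lt_of_le (by positivity) h1
    have hx2 : √τ ^ 2 = τ := Real.sq_sqrt hτ.le
    have h3 := h.pow_four_mul_le (Real.sqrt_pos.2 hτ) (by rw [hx2, hw]; exact h1)
      (by rw [hx2, hw]; exact h2)
    have hw2 : w ^ 2 = (4 * (k : ℝ) + 2 * δ + 2) ^ ((1 : ℝ) / 3) := by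
      rw [← hw, ← Real.rpow_natCast_mul (by linarith), ← Real.rpow_natCast]
      norm_num
    rw [hrad hτ, hx2, hw2, hw, mul_pow,
      show √(√τ) ^ 4 = τ by rw [show (4 : ℕ) = 2 * 2 by rfl, pow_mul,
        Real.sq_sqrt (Real.sqrt_nonneg _), hx2]] at h3
    set ν := 4 * (k : ℝ) + 2 * δ + 2
    have hc : 0 < ν ^ ((1 : ℝ) / 3) + |ν - τ| := by positivity
    refine (abs_le_mul_rpow_mul_rpow (D := 2 * B + 1) (by positivity) hν hc ?_).trans ?_
    · have h4 : laguerreNorm k δ τ ^ 4 * ν * (ν ^ ((1 : ℝ) / 3) + |ν - τ|) ≤ 2 * B := by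
        calc _ ≤ laguerreNorm k δ τ ^ 4 * (2 * τ) * (ν ^ ((1 : ℝ) / 3) + |ν - τ|) := by
              gcongr
              linarith
          _ = 2 * (τ * laguerreNorm k δ τ ^ 4 * (ν ^ ((1 : ℝ) / 3) + |ν - τ|)) := by ring
          _ ≤ 2 * B := by gcongr
      have h5 : 2 * B + 1 ≤ (2 * B + 1) ^ 4 := le_self_pow₀ (by linarith) (by norm_num)
      linarith
    · gcongr ?_ * _ * _
      linarith [Real.sqrt_nonneg A, Real.sqrt_nonneg (12 * K)]
  · have hτ : 0 < τ := lt_of_lt_of_le (by positivity) h1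
    have hx2 : √τ ^ 2 = τ := Real.sq_sqrt hτ.le
    have h3 := h.sq_le_exp (Real.sqrt_pos.2 hτ) (by rw [hx2, hw]; exact h1)
    have h4 : 1 ≤ √τ := by
      rw [Real.one_le_sqrt]
      have : (10 : ℝ) ^ 6 ≤ w ^ 6 := by gcongr
      linarith
    rw [hrad hτ, mul_pow, Real.sq_sqrt (Real.sqrt_nonneg _), hx2] at h3
    have h5 : laguerreNorm k δ τ ^ 2 ≤ (√A * Real.exp (-(1 / 36) * τ)) ^ 2 := by
      rw [mul_pow, Real.sq_sqrt hA0, ← Real.exp_nat_mul]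
      rw [show ((2 : ℕ) : ℝ) * (-(1 / 36) * τ) = -τ / 18 by push_cast; ring]
      exact (le_mul_of_one_le_left (sq_nonneg _) h4).trans h3
    refine (abs_le_of_sq_le_sq h5 (by positivity)).trans ?_
    gcongr
    linarith [Real.sqrt_nonneg (12 * K)]

theorem exists_abs_laguerreNorm_le_exp (k : ℕ) {δ m : ℝ} (hδ : -1 < δ) (hm : 0 < m) :
    ∃ C ≥ 0, ∀ τ ≥ m, |laguerreNorm k δ τ| ≤ C * Real.exp (-(1 / 36) * τ) := by
  set f : ℝ → ℝ := fun τ => τ ^ (δ / 2) * (laguerrePoly k δ).eval τ * Real.exp (-(17 / 36) * τ)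
    with hf
  have ht : Filter.Tendsto f Filter.atTop (nhds 0) :=
    tendsto_rpow_mul_eval_mul_exp_neg _ _ (by norm_num)
  obtain ⟨T, hT⟩ := Filter.eventually_atTop.1
    (ht.abs.eventually_le_const (show |(0 : ℝ)| < 1 by simp))
  have hcont : ContinuousOn f (Set.Icc m T) := by
    refine ContinuousOn.mul (ContinuousOn.mul ?_ ?_) ?_
    · exact ContinuousOn.rpow_const continuousOn_id fun x hx => Or.inl (hm.trans_le hx.1).ne'
    · exact (laguerrePoly k δ).continuous.continuousOn
    · fun_prop
  obtain ⟨D, hD⟩ := isCompact_Icc.exists_bound_of_continuousOn hcont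
  set N := √(Real.Gamma (k + 1) / Real.Gamma (k + δ + 1)) with hN
  refine ⟨N * (1 + |D|), by positivity, fun τ hτ => ?_⟩
  have hfb : |f τ| ≤ 1 + |D| := by
    rcases le_total T τ with h | h
    · exact (hT τ h).trans (by linarith [abs_nonneg D])
    · exact (hD τ ⟨hτ, h⟩).trans (by linarith [le_abs_self D])
  have heq : laguerreNorm k δ τ = N * f τ * Real.exp (-(1 / 36) * τ) := by
    rw [laguerreNorm_eq k hδ (hm.trans_le hτ), hf, ← hN,
      show -τ / 2 = -(17 / 36) * τ + -(1 / 36) * τ by ring, Real.exp_add]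
    ring
  rw [heq, abs_mul, abs_mul, abs_of_nonneg (Real.sqrt_nonneg _), Real.abs_exp]
  gcongr

theorem exists_laguerreBounds (k : ℕ) {δ : ℝ} (hδ : -1 < δ) :
    ∃ C ≥ 0, LaguerreBounds C δ k := by
  have hν := spectral_pos k hδ
  set ν := 4 * (k : ℝ) + 2 * δ + 2 with hν'
  have hm : 0 < min (1 / ν) (ν / 2) := lt_min (by positivity) (by positivity)
  obtain ⟨C, hC, h⟩ := exists_abs_laguerreNorm_le_exp k hδ hm
  set p := (ν / 2 * ν) ^ (-(1 : ℝ) / 4) with hp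
  have hp0 : 0 < p := by positivity
  set q := ν ^ (-(1 : ℝ) / 4) * (ν ^ ((1 : ℝ) / 3) + ν) ^ (-(1 : ℝ) / 4) with hq
  have hq0 : 0 < q := by positivity
  have hle : ∀ τ ≥ min (1 / ν) (ν / 2), |laguerreNorm k δ τ| ≤ C := fun τ hτ =>
    (h τ hτ).trans <| mul_le_of_le_one_right hC <|
      Real.exp_le_one_iff.2 (by linarith)
  refine ⟨C + C / p + C / q, by positivity, fun τ => ?_⟩
  rw [← hν']
  refine ⟨fun h1 h2 => ?_, fun h1 h2 => ?_, fun h1 => ?_⟩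
  · have hτ : 0 < τ := lt_of_lt_of_le (by positivity) h1
    have h3 : p ≤ (τ * ν) ^ (-(1 : ℝ) / 4) :=
      Real.rpow_le_rpow_of_nonpos (by positivity) (by gcongr) (by norm_num)
    calc _ ≤ C := hle τ ((min_le_left _ _).trans h1)
      _ = C / p * p := (div_mul_cancel₀ _ hp0.ne').symm
      _ ≤ _ := by
        gcongr
        linarith [show 0 ≤ C / q by positivity]
  · have h3 : |ν - τ| ≤ ν := abs_le.2 ⟨by linarith, by linarith⟩
    have h4 : q ≤ ν ^ (-(1 : ℝ) / 4) * (ν ^ ((1 : ℝ) / 3) + |ν - τ|) ^ (-(1 : ℝ) / 4) :=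
      mul_le_mul_of_nonneg_left
        (Real.rpow_le_rpow_of_nonpos (by positivity) (by gcongr) (by norm_num)) (by positivity)
    rw [mul_assoc]
    calc _ ≤ C := hle τ ((min_le_right _ _).trans h1)
      _ = C / q * q := (div_mul_cancel₀ _ hq0.ne').symm
      _ ≤ _ := by
        gcongr
        linarith [show 0 ≤ C / p by positivity]
  · refine (h τ ((min_le_right _ _).trans (by linarith))).trans ?_
    gcongr
    linarith [show 0 ≤ C / p by positivity, show 0 ≤ C / q by positivity]

theorem laguerre_asymptotics (δ : ℝ) (hδ : -1 < δ) :
    ∃ C > (0 : ℝ), ∃ γ > (0 : ℝ), ∀ k : ℕ, ∀ τ : ℝ,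
      (0 ≤ τ → τ ≤ 1 / (4 * (k : ℝ) + 2 * δ + 2) →
        |laguerreNorm k δ τ| ≤ C * (τ * (4 * (k : ℝ) + 2 * δ + 2)) ^ (δ / 2)) ∧
      (1 / (4 * (k : ℝ) + 2 * δ + 2) ≤ τ → τ ≤ (4 * (k : ℝ) + 2 * δ + 2) / 2 →
        |laguerreNorm k δ τ| ≤ C * (τ * (4 * (k : ℝ) + 2 * δ + 2)) ^ (-(1 : ℝ) / 4)) ∧
      ((4 * (k : ℝ) + 2 * δ + 2) / 2 ≤ τ → τ ≤ 3 * (4 * (k : ℝ) + 2 * δ + 2) / 2 →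
        |laguerreNorm k δ τ| ≤ C * (4 * (k : ℝ) + 2 * δ + 2) ^ (-(1 : ℝ) / 4) *
          ((4 * (k : ℝ) + 2 * δ + 2) ^ ((1 : ℝ) / 3) +
            |4 * (k : ℝ) + 2 * δ + 2 - τ|) ^ (-(1 : ℝ) / 4)) ∧
      (3 * (4 * (k : ℝ) + 2 * δ + 2) / 2 ≤ τ →
        |laguerreNorm k δ τ| ≤ C * Real.exp (-γ * τ)) := by
  obtain ⟨C₁, hC₁, h₁⟩ := exists_abs_laguerreNorm_le_rpow_of_nonneg hδ
  obtain ⟨C₂, k₀, h₂⟩ := exists_laguerreBounds_of_ge hδ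
  choose c hc h₃ using fun k : ℕ => exists_laguerreBounds k hδ
  have hS : 0 ≤ ∑ j ∈ Finset.range k₀, c j := Finset.sum_nonneg fun j _ => hc j
  refine ⟨C₁ + |C₂| + ∑ j ∈ Finset.range k₀, c j, by positivity, 1 / 36, by norm_num,
    fun k τ => ⟨fun h0 h1 => (h₁ k τ h0 h1).trans ?_, ?_⟩⟩
  · have hν := spectral_pos k hδ
    gcongr
    linarith [abs_nonneg C₂]
  · rcases lt_or_ge k k₀ with hk | hk
    · refine (h₃ k).mono hδ ?_ τ
      have := Finset.single_le_sum (fun j _ => hc j) (Finset.mem_range.2 hk)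
      linarith [abs_nonneg C₂]
    · refine (h₂ k hk).mono hδ ?_ τ
      linarith [le_abs_self C₂]
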